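/- Independence of the Heisenberg current from the chosen distance: let 1 ≤ k ≤ n, let O ⊆ ℍ^n be open, let d₁, d₂ be two left invariant, homogeneous and rotationally invariant distances on ℍ^n with associated spherical Hausdorff measures 𝒮^m₁, 𝒮^m₂ and geometric constants C¹_{n,k}, C²_{n,k}. Let S ⊆ O be an oriented k-codimensional C¹_ℍ-regular submanifold such that 𝒮^{Q−k}₁⌊S and 𝒮^{Q−k}₂⌊S are locally finite on O. Then (1/C¹_{n,k}) ∫_S ⟨t^ℍ_S | ω⟩ d𝒮^{Q−k}₁ = (1/C²_{n,k}) ∫_S ⟨t^ℍ_S | ω⟩ d𝒮^{Q−k}₂ for every ω ∈ 𝒟^{2n+1−k}_ℍ(O). -/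

import Mathlib

open MeasureTheory Topology Filter Set ENNReal

noncomputable section
namespace Heis

/-- Points of the `n`-th Heisenberg group `ℍⁿ ≡ ℝⁿ × ℝⁿ × ℝ`, `p = (x, y, t)`. -/
abbrev Hpt (n : ℕ) : Type := (Fin n → ℝ) × (Fin n → ℝ) × ℝ

variable {n : ℕ}

/-- The Heisenberg group operation. -/
def hmul (p q : Hpt n) : Hpt n :=
  (p.1 + q.1, p.2.1 + q.2.1,
    p.2.2 + q.2.2 + (∑ j, p.1 j * q.2.1 j) / 2 - (∑ j, q.1 j * p.2.1 j) / 2)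

/-- Group inverse. -/
def hinv (p : Hpt n) : Hpt n := (-p.1, -p.2.1, -p.2.2)

/-- Anisotropic dilations `δ_λ(x,y,t) = (λx, λy, λ²t)`. -/
def hdil (l : ℝ) (p : Hpt n) : Hpt n := (l • p.1, l • p.2.1, l ^ 2 * p.2.2)

/-- The value at `p` of the `j`-th left invariant frame field `X₁,…,Xₙ,Y₁,…,Yₙ,T`,
expressed in the coordinates of `ℝ^{2n+1}`. -/
def frameVec (j : Fin (2*n+1)) (p : Hpt n) : Hpt n :=
  if h : (j : ℕ) < n then
    (Pi.single (⟨j, h⟩ : Fin n) 1, 0, -(p.2.1 ⟨j, h⟩) / 2)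
  else if h' : (j : ℕ) < 2*n then
    (0, Pi.single (⟨(j:ℕ) - n, by omega⟩ : Fin n) 1, p.1 ⟨(j:ℕ) - n, by omega⟩ / 2)
  else (0, 0, 1)

/-- Inclusion of horizontal indices. -/
def hIdx (j : Fin (2*n)) : Fin (2*n+1) := Fin.castLE (by omega) j

/-- Horizontal gradient `∇_ℍ f = (X₁f,…,Xₙf,Y₁f,…,Yₙf)` (pointwise derivatives along the
horizontal left-invariant fields). -/
def gradH (f : Hpt n → ℝ) (p : Hpt n) : Fin (2*n) → ℝ :=
  fun j => lineDeriv ℝ f p (frameVec (hIdx j) p)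

/-- `f` is of class `C¹_ℍ` on `U`: it is continuous and its horizontal derivatives exist and
are (represented by) continuous functions on `U`. -/
structure IsC1H (U : Set (Hpt n)) (f : Hpt n → ℝ) : Prop where
  contOn : ContinuousOn f U
  ldiff : ∀ p ∈ U, ∀ j : Fin (2*n), LineDifferentiableAt ℝ f p (frameVec (hIdx j) p)
  contGrad : ∀ j : Fin (2*n), ContinuousOn (fun p => gradH f p j) U

/-- Horizontal gradient as a frame-coefficient vector in `ℝ^{2n+1}` (with zero `T`-component). -/
def gradF (f : Hpt n → ℝ) (q : Hpt n) : Fin (2*n+1) → ℝ :=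
  fun j => if h : (j:ℕ) < 2*n then gradH f q ⟨j, h⟩ else 0

/-- Horizontal derivative indexed by a natural number (0 outside the horizontal range). -/
def gradNat (f : Hpt n → ℝ) (q : Hpt n) (i : ℕ) : ℝ :=
  if h : i < 2*n then gradH f q ⟨i, h⟩ else 0

/-- The Pansu differential of a `C¹_ℍ` function: `d_ℍf_p(x,y,t) = Σⱼ(xⱼXⱼf(p) + yⱼYⱼf(p))`. -/
def pansuD (f : Hpt n → ℝ) (p : Hpt n) (q : Hpt n) : ℝ :=
  ∑ j : Fin n, (q.1 j * gradH f p ⟨(j:ℕ), by omega⟩ + q.2.1 j * gradH f p ⟨n + (j:ℕ), by omega⟩)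

/-- `S` is a `k`-codimensional `C¹_ℍ`-regular submanifold. -/
def IsC1HCodim (k : ℕ) (S : Set (Hpt n)) : Prop :=
  ∀ p ∈ S, ∃ U : Set (Hpt n), IsOpen U ∧ p ∈ U ∧
    ∃ f : Fin k → Hpt n → ℝ,
      (∀ i, IsC1H U (f i)) ∧
      (∀ q ∈ U, LinearIndependent ℝ (fun i => gradH (f i) q)) ∧
      S ∩ U = {q ∈ U | ∀ i, f i q = 0}

/-- `L : ℝ^k → ℍⁿ` is a group homomorphism. -/
def IsGroupHomH {k : ℕ} (L : (Fin k → ℝ) → Hpt n) : Prop :=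
  ∀ a b, L (a + b) = hmul (L a) (L b)

/-- Pansu differentiability of `f : ℝ^k → ℍⁿ` at `a`:
`δ_{1/λ}(f(a)⁻¹ ⬝ f(a + λb)) → L(b)` locally uniformly in `b`, with `L` a group homomorphism. -/
def HasPansuDerivAt {k : ℕ} (f : (Fin k → ℝ) → Hpt n) (L : (Fin k → ℝ) → Hpt n)
    (a : Fin k → ℝ) : Prop :=
  IsGroupHomH L ∧
    TendstoLocallyUniformly
      (fun (l : ℝ) (b : Fin k → ℝ) => hdil l⁻¹ (hmul (hinv (f a)) (f (a + l • b)))) L (𝓝[>] 0)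

/-- `S` is a `k`-dimensional (`k ≤ n`) `C¹_ℍ`-regular submanifold: locally the injective image
of an open set of `ℝ^k` under a continuously Pansu differentiable map with injective
Pansu differential. -/
def IsC1HDim (k : ℕ) (S : Set (Hpt n)) : Prop :=
  ∀ p ∈ S, ∃ U : Set (Hpt n), IsOpen U ∧ p ∈ U ∧
    ∃ V : Set (Fin k → ℝ), IsOpen V ∧
    ∃ (f : (Fin k → ℝ) → Hpt n) (Df : (Fin k → ℝ) → (Fin k → ℝ) → Hpt n),
      Set.InjOn f V ∧ Set.MapsTo f V U ∧
      (∀ a ∈ V, HasPansuDerivAt f (Df a) a ∧ Function.Injective (Df a)) ∧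
      (∀ b, ContinuousOn (fun a => Df a b) V) ∧
      S ∩ U = f '' V

/-- `C¹_ℍ`-regular submanifold of codimension `k`, for any `1 ≤ k ≤ 2n+1` (for `k ≥ n+1` this
means a low-dimensional submanifold of dimension `2n+1-k`). -/
def IsC1HSub (k : ℕ) (S : Set (Hpt n)) : Prop :=
  if k ≤ n then IsC1HCodim k S else IsC1HDim (2*n+1-k) S

/-! ## Distances and measures -/

/-- Open ball of a distance function. -/
def rawBall (d : Hpt n → Hpt n → ℝ) (p : Hpt n) (r : ℝ) : Set (Hpt n) := {q | d p q < r}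

/-- The gauge used to define the spherical Hausdorff measure of dimension `m` at scale `r`. -/
def sphGauge (d : Hpt n → Hpt n → ℝ) (m r : ℝ) (s : Set (Hpt n)) : ℝ≥0∞ :=
  ⨅ (c : Hpt n) (ρ : ℝ) (_ : 0 < ρ) (_ : ρ < r) (_ : s ⊆ rawBall d c ρ),
    ENNReal.ofReal ((2*ρ) ^ m)

/-- Spherical pre-measure at scale `r`. -/
def sphPre (d : Hpt n → Hpt n → ℝ) (m r : ℝ) : OuterMeasure (Hpt n) :=
  OuterMeasure.boundedBy (sphGauge d m r)

/-- The spherical Hausdorff outer measure `𝒮^m` associated with `d`. -/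
def sphOuter (d : Hpt n → Hpt n → ℝ) (m : ℝ) : OuterMeasure (Hpt n) :=
  ⨆ (r : ℝ) (_ : 0 < r), sphPre d m r

/-- A left invariant, homogeneous, rotationally invariant distance on `ℍⁿ`.
(The field `carat` records the — automatically true — fact that Borel sets are
Carathéodory measurable for the associated spherical measures.) -/
structure HomDist (n : ℕ) where
  d : Hpt n → Hpt n → ℝ
  symm : ∀ p q, d p q = d q p
  triangle : ∀ p q r, d p r ≤ d p q + d q r
  eq_iff : ∀ p q, d p q = 0 ↔ p = q
  leftInv : ∀ g p q, d (hmul g p) (hmul g q) = d p q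
  homog : ∀ l : ℝ, 0 < l → ∀ p q, d (hdil l p) (hdil l q) = l * d p q
  rotInv : ∀ p q : Hpt n,
    (∑ j, (p.1 j ^ 2 + p.2.1 j ^ 2)) = (∑ j, (q.1 j ^ 2 + q.2.1 j ^ 2)) →
    p.2.2 = q.2.2 → d 0 p = d 0 q
  carat : ∀ m : ℝ,
    (inferInstance : MeasurableSpace (Hpt n)) ≤ (sphOuter d m).caratheodory

/-- Open ball `U(p,r)` of a homogeneous distance. -/
def hball (D : HomDist n) (p : Hpt n) (r : ℝ) : Set (Hpt n) := rawBall D.d p r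

/-- The spherical Hausdorff measure `𝒮^m` of a homogeneous distance, as a measure. -/
def sphMeasure (D : HomDist n) (m : ℝ) : Measure (Hpt n) :=
  (sphOuter D.d m).toMeasure (D.carat m)

/-- `μ⌊A` is locally finite on `O`. -/
def LocFin (μ : Measure (Hpt n)) (A O : Set (Hpt n)) : Prop :=
  ∀ p ∈ O, ∃ U : Set (Hpt n), IsOpen U ∧ p ∈ U ∧ μ (A ∩ U) < ⊤

/-! ## Euclidean coordinates and Euclidean Hausdorff measures -/

/-- Realization of a coordinate vector `c ∈ ℝ^{2n+1}` as a point/tangent vector of `ℍⁿ`. -/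
def rE (c : Fin (2*n+1) → ℝ) : Hpt n :=
  (fun i => c ⟨(i:ℕ), by omega⟩, fun i => c ⟨n + (i:ℕ), by omega⟩, c ⟨2*n, by omega⟩)

/-- Coordinates of a point/tangent vector of `ℍⁿ` as a vector of `ℝ^{2n+1}`. -/
def toEc (q : Hpt n) : Fin (2*n+1) → ℝ := fun j =>
  if h : (j:ℕ) < n then q.1 ⟨j, h⟩
  else if h' : (j:ℕ) < 2*n then q.2.1 ⟨(j:ℕ) - n, by omega⟩
  else q.2.2

/-- Identification of `ℍⁿ` with the Euclidean space `ℝ^{2n+1}`. -/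
def ofE (q : EuclideanSpace ℝ (Fin (2*n+1))) : Hpt n := rE (fun j => q j)

/-- The `m`-dimensional Euclidean Hausdorff measure on `ℍⁿ ≡ ℝ^{2n+1}`. -/
def muE (n : ℕ) (m : ℝ) : Measure (Hpt n) :=
  Measure.map ofE (μH[m] : Measure (EuclideanSpace ℝ (Fin (2*n+1))))

/-! ## Multivectors -/

/-- Index sets for a basis of `Λ_k 𝔥`. -/
def IdxSet (n k : ℕ) := {s : Finset (Fin (2*n+1)) // s.card = k}

instance (n k : ℕ) : Fintype (IdxSet n k) := by unfold IdxSet; infer_instance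

/-- The increasing enumeration of an index set. -/
def idxTuple {k : ℕ} (s : IdxSet n k) (i : Fin k) : Fin (2*n+1) :=
  ((s.1.orderIsoOfFin s.2) i).1

/-- `k`-vectors, as coefficients with respect to the canonical basis of `Λ_k ℝ^{2n+1}`. -/
abbrev MVec (n k : ℕ) := IdxSet n k → ℝ

/-- The simple `k`-vector `v₁ ∧ ⋯ ∧ v_k`. -/
def simpleWedge {k : ℕ} (v : Fin k → (Fin (2*n+1) → ℝ)) : MVec n k :=
  fun s => Matrix.det (Matrix.of fun i j => v i (idxTuple s j))

/-- Degree cast for multivectors. -/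
def mvCast {a b : ℕ} (h : a = b) (t : MVec n a) : MVec n b :=
  fun s => t ⟨s.1, by rw [h]; exact s.2⟩

/-- Euclidean scalar product of coefficient vectors. -/
def dotC (a b : Fin (2*n+1) → ℝ) : ℝ := ∑ j, a j * b j

/-- Pairing `⟨t | η⟩` at `p` of a `k`-vector (in the left invariant frame `X₁,…,Yₙ,T`)
with a `k`-form. -/
def pairF {k : ℕ} (t : MVec n k) (p : Hpt n) (η : (Fin k → Hpt n) → ℝ) : ℝ :=
  ∑ s, t s * η (fun i => frameVec (idxTuple s i) p)

/-- The `j`-th coordinate basis vector of `ℝ^{2n+1}`. -/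
def coordC (j : Fin (2*n+1)) : Fin (2*n+1) → ℝ := fun j' => if j' = j then 1 else 0

/-- Pairing `⟨t | η⟩` of a `k`-vector (in the coordinate basis `∂x,∂y,∂t`) with a `k`-form. -/
def pairE {k : ℕ} (t : MVec n k) (η : (Fin k → Hpt n) → ℝ) : ℝ :=
  ∑ s, t s * η (fun i => rE (coordC (idxTuple s i)))

/-- Realization of a frame-coefficient vector as a tangent vector at `p`. -/
def rF (c : Fin (2*n+1) → ℝ) (p : Hpt n) : Hpt n := ∑ j, c j • frameVec j p

/-! ## Covectors and Heisenberg forms -/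

/-- `k`-covectors on `ℍⁿ`. -/
abbrev Cov (n k : ℕ) := AlternatingMap ℝ (Hpt n) ℝ (Fin k)

/-- Wedge product of covectors. -/
def cwedge {k l : ℕ} (α : Cov n k) (β : Cov n l) : Cov n (k + l) :=
  AlternatingMap.domDomCongr finSumFinEquiv
    ((TensorProduct.lid ℝ ℝ).toLinearMap.compAlternatingMap (AlternatingMap.domCoprod α β))

/-- Degree cast for covectors. -/
def covCast {a b : ℕ} (h : a = b) (α : Cov n a) : Cov n b :=
  AlternatingMap.domDomCongr (finCongr h) α

def projX (j : Fin n) : Hpt n →ₗ[ℝ] ℝ := (LinearMap.proj j).comp (LinearMap.fst ℝ _ _)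

def projY (j : Fin n) : Hpt n →ₗ[ℝ] ℝ :=
  (LinearMap.proj j).comp ((LinearMap.fst ℝ _ _).comp (LinearMap.snd ℝ _ _))

def projT : Hpt n →ₗ[ℝ] ℝ := (LinearMap.snd ℝ _ _).comp (LinearMap.snd ℝ _ _)

/-- The contact form `θ = dt + ½Σⱼ(yⱼdxⱼ − xⱼdyⱼ)` at `p`, as a linear functional. -/
def thetaLin (p : Hpt n) : Hpt n →ₗ[ℝ] ℝ :=
  projT + (2:ℝ)⁻¹ • (∑ j : Fin n, (p.2.1 j • projX j - p.1 j • projY j))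

/-- A linear functional as a `1`-covector. -/
def cov1 (L : Hpt n →ₗ[ℝ] ℝ) : Cov n 1 :=
  AlternatingMap.ofSubsingleton ℝ (Hpt n) ℝ (0 : Fin 1) L

/-- `θ` as a `1`-covector. -/
def thetaC (p : Hpt n) : Cov n 1 := cov1 (thetaLin p)

/-- `dθ = −Σⱼ dxⱼ∧dyⱼ` as a (constant) `2`-covector. -/
def dthetaC : Cov n 2 := -∑ j : Fin n, cwedge (cov1 (projX j)) (cov1 (projY j))

/-- Membership in the Rumin ideal `ℐ^k = {λ∧θ + μ∧dθ}` at the point `p`. -/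
def memI {k : ℕ} (p : Hpt n) (ω : Cov n k) : Prop :=
  ∃ (a : Cov n (k-1)) (ω₂ : Cov n k) (h1 : (k-1)+1 = k),
    ω = covCast h1 (cwedge a (thetaC p)) + ω₂ ∧
    (ω₂ = 0 ∨ ∃ (b : Cov n (k-2)) (h2 : (k-2)+2 = k), ω₂ = covCast h2 (cwedge b dthetaC))

/-- Membership in `𝒥^k = {λ : λ∧θ = λ∧dθ = 0}` at the point `p`. -/
def memJ {k : ℕ} (p : Hpt n) (ω : Cov n k) : Prop :=
  cwedge ω (thetaC p) = 0 ∧ cwedge ω dthetaC = 0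

/-- A compactly supported smooth Heisenberg `k`-form on `O` (for `k ≤ n` the values are
representatives of classes modulo `ℐ^k`; for `k ≥ n+1` they lie in `𝒥^k`). -/
structure IsHFormD (k : ℕ) (O : Set (Hpt n)) (ω : Hpt n → Cov n k) : Prop where
  smooth : ∀ v : Fin k → Hpt n, ContDiff ℝ (⊤ : ℕ∞) fun p => ω p v
  cptSupp : ∃ K : Set (Hpt n), IsCompact K ∧ K ⊆ O ∧ ∀ p ∉ K, ω p = 0
  vert : n + 1 ≤ k → ∀ p, memJ p (ω p)

/-- Exterior derivative (as a raw multilinear expression):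
`dω_p(v₀,…,v_k) = Σᵢ (−1)ⁱ ∂_{vᵢ}(q ↦ ω_q(v₀,…,v̂ᵢ,…,v_k))(p)`. -/
def extD {k : ℕ} (ω : Hpt n → Cov n k) (p : Hpt n) (v : Fin (k+1) → Hpt n) : ℝ :=
  ∑ i : Fin (k+1), (-1 : ℝ)^(i:ℕ) * fderiv ℝ (fun q => ω q (v ∘ i.succAbove)) p (v i)

/-- `η` is the Rumin operator `D` applied to `ω` (only meaningful in degree `k = n`):
`Dω = d(ω − θ∧β)` where `β = L⁻¹((dω)_{𝔥₁})`, i.e. `β` is horizontal and `β∧dθ` agrees with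
`dω` on horizontal vectors. -/
def IsRuminD {k : ℕ} (ω : Hpt n → Cov n k) (η : Hpt n → (Fin (k+1) → Hpt n) → ℝ) : Prop :=
  ∃ (β : Hpt n → Cov n (k-1)) (h1 : 1 + (k-1) = k) (h2 : (k-1)+2 = k+1),
    (∀ v, ContDiff ℝ (⊤ : ℕ∞) fun p => β p v) ∧
    (∀ (p : Hpt n) (v : Fin (k-1) → Hpt n) (i : Fin (k-1)),
      v i = ((0:Fin n → ℝ), (0:Fin n → ℝ), (1:ℝ)) → β p v = 0) ∧
    (∀ (p : Hpt n) (v : Fin (k+1) → Hpt n), (∀ i, thetaLin p (v i) = 0) →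
      extD ω p v = covCast h2 (cwedge (β p) dthetaC) v) ∧
    η = extD (fun p => ω p - covCast h1 (cwedge (thetaC p) (β p)))

/-- The Rumin differential `d_c`: the exterior derivative in degree `k ≠ n`, the second order
operator `D` in the critical degree `k = n`. -/
def IsDc {k : ℕ} (ω : Hpt n → Cov n k) (η : Hpt n → (Fin (k+1) → Hpt n) → ℝ) : Prop :=
  if k = n then IsRuminD ω η else η = extD ω

/-- Degree cast for raw forms. -/
def rawCast {a b : ℕ} (h : a = b) (η : (Fin a → Hpt n) → ℝ) : (Fin b → Hpt n) → ℝ :=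
  fun v => η (fun i => v (Fin.cast h i))

/-! ## Orientations and currents -/

/-- `t` is a unit tangent `m`-vector of the `k`-codimensional `C¹_ℍ` submanifold `S` at `p`,
i.e. `t = ±*n^ℍ_S(p)`: `t` is the wedge of an orthonormal basis of `ker d_ℍf_p`
(in the left invariant frame). -/
def IsHTangentVecAt (k m : ℕ) (S : Set (Hpt n)) (p : Hpt n) (t : MVec n m) : Prop :=
  ∃ (U : Set (Hpt n)) (f : Fin k → Hpt n → ℝ), IsOpen U ∧ p ∈ U ∧
    (∀ i, IsC1H U (f i)) ∧
    (∀ q ∈ U, LinearIndependent ℝ (fun i => gradH (f i) q)) ∧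
    S ∩ U = {q ∈ U | ∀ i, f i q = 0} ∧
    ∃ v : Fin m → (Fin (2*n+1) → ℝ),
      (∀ i j, dotC (v i) (v j) = if i = j then 1 else 0) ∧
      (∀ i l, dotC (v i) (gradF (f l) p) = 0) ∧
      t = simpleWedge v

/-- An orientation of a `k`-codimensional `C¹_ℍ` submanifold: a continuous global choice of
the unit tangent `(2n+1−k)`-vector `t^ℍ_S` (here of formal degree `m`). -/
def IsHOrient (k m : ℕ) (S : Set (Hpt n)) (t : Hpt n → MVec n m) : Prop :=
  ContinuousOn t S ∧ ∀ p ∈ S, IsHTangentVecAt k m S p (t p)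

/-- Classical Euclidean unit tangent `m`-vector at a point of an `m`-dimensional submanifold
(coefficients in the coordinate basis). -/
def IsEuclTangentVecAt (m : ℕ) (S : Set (Hpt n)) (p : Hpt n) (t : MVec n m) : Prop :=
  ∃ v : Fin m → (Fin (2*n+1) → ℝ),
    (∀ i j, dotC (v i) (v j) = if i = j then 1 else 0) ∧
    (∀ i, rE (v i) ∈ tangentConeAt ℝ S p) ∧ t = simpleWedge v

/-- Classical (Euclidean) orientation of a low-dimensional submanifold. -/
def IsEuclOrient (m : ℕ) (S : Set (Hpt n)) (t : Hpt n → MVec n m) : Prop :=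
  ContinuousOn t S ∧ ∀ p ∈ S, IsEuclTangentVecAt m S p (t p)

/-- The standard vertical subgroup `𝕎` of codimension `k`. -/
def Wstd (n k : ℕ) : Set (Hpt n) := {p | ∀ i : Fin n, (i:ℕ) < k → p.1 i = 0}

/-- Embedding realizing `𝕎` as a Euclidean space. -/
def wEmbed (n k : ℕ) (a : ({i : Fin n // k ≤ (i:ℕ)} → ℝ) × (Fin n → ℝ) × ℝ) : Hpt n :=
  (fun i => if h : k ≤ (i:ℕ) then a.1 ⟨i, h⟩ else 0, a.2.1, a.2.2)

/-- Lebesgue measure `ℒ^{2n+1−k}` on the vertical subgroup `𝕎`. -/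
def wLeb (n k : ℕ) : Measure (Hpt n) := Measure.map (wEmbed n k) volume

/-- The geometric constant
`C_{n,k} = (sup{ℒ^{2n+1−k}(𝕎 ∩ U(p,1)) : p ∈ U(0,1)})⁻¹`. -/
def CnkC (D : HomDist n) (k : ℕ) : ℝ :=
  (sSup {v : ℝ | ∃ p ∈ hball D 0 1, v = (wLeb n k (Wstd n k ∩ hball D p 1)).toReal})⁻¹

/-- The Heisenberg current `⟦S⟧` of an oriented `k`-codimensional (`k ≤ n`) submanifold:
`⟦S⟧(ω) = (1/C_{n,k}) ∫_S ⟨t^ℍ_S | ω⟩ d𝒮^{Q−k}`. -/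
def currF (D : HomDist n) (k : ℕ) (S : Set (Hpt n)) (t : Hpt n → MVec n (2*n+1-k))
    (η : Hpt n → (Fin (2*n+1-k) → Hpt n) → ℝ) : ℝ :=
  (CnkC D k)⁻¹ * ∫ p in S, pairF (t p) p (η p) ∂(sphMeasure D ((2*n+2 : ℝ) - (k : ℝ)))

/-- The current of an oriented low-dimensional (`m ≤ n`) submanifold: the classical integral
`⟦S⟧(ω) = ∫_S ⟨τ_S | ω⟩ d𝓗^m_E`. -/
def currE {n : ℕ} (m : ℕ) (S : Set (Hpt n)) (t : Hpt n → MVec n m)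
    (η : Hpt n → (Fin m → Hpt n) → ℝ) : ℝ :=
  ∫ p in S, pairE (t p) (η p) ∂(muE n (m : ℝ))

/-- The Heisenberg current of an oriented `m`-dimensional submanifold (any `m`). -/
def hCurr (D : HomDist n) (m : ℕ) (S : Set (Hpt n)) (t : Hpt n → MVec n m)
    (η : Hpt n → (Fin m → Hpt n) → ℝ) : ℝ :=
  if m ≤ n then currE m S t η
  else if h2 : m ≤ 2*n+1 then
    currF D (2*n+1-m) S (fun p => mvCast (by omega) (t p)) (fun p => rawCast (by omega) (η p))
  else 0

/-- Orientation of an `m`-dimensional submanifold (any `m`): Euclidean in low dimension,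
the continuous unit tangent field `t^ℍ_S` in low codimension. -/
def IsOrientS (m : ℕ) (S : Set (Hpt n)) (t : Hpt n → MVec n m) : Prop :=
  if m ≤ n then IsEuclOrient m S t else IsHOrient (2*n+1-m) m S t

/-! ## Submanifolds with boundary -/

/-- The boundary `∂S = S̄ ∖ S`. -/
def bdry (S : Set (Hpt n)) : Set (Hpt n) := closure S \ S

/-- `S` is a `k`-codimensional `C¹_ℍ`-regular submanifold with boundary in `O`. -/
def IsC1HSubWithBdry (D : HomDist n) (k : ℕ) (O : Set (Hpt n)) (S : Set (Hpt n)) : Prop :=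
  (O ∩ S).Nonempty ∧ IsC1HSub k (O ∩ S) ∧
  (O ∩ bdry S).Nonempty ∧ IsC1HSub (k+1) (O ∩ bdry S) ∧
  ∀ p ∈ O ∩ bdry S, ∃ U : Set (Hpt n), IsOpen U ∧ p ∈ U ∧
    ∃ S' : Set (Hpt n), S' ⊆ U ∧ IsC1HSub k S' ∧ U ∩ closure S ⊆ S' ∧
      ∀ r : ℝ, 0 < r → (hball D p r ∩ (S' \ closure S)).Nonempty

/-- A family `f₁,…,f_{k+1}` of local defining functions at a boundary point `p`, as in the
characterization of `k`-codimensional submanifolds with boundary: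
`U ∩ S = {f₁ = ⋯ = f_k = 0, f_{k+1} > 0}` and `f_{k+1}(p) = 0`. -/
def IsBdryFrame (k : ℕ) (S : Set (Hpt n)) (p : Hpt n) (U : Set (Hpt n))
    (f : Fin (k+1) → Hpt n → ℝ) : Prop :=
  IsOpen U ∧ p ∈ U ∧ (∀ i, IsC1H U (f i)) ∧
  (∀ q ∈ U, LinearIndependent ℝ (fun i => gradH (f i) q)) ∧
  U ∩ S = {q ∈ U | (∀ i : Fin k, f i.castSucc q = 0) ∧ 0 < f (Fin.last k) q} ∧
  f (Fin.last k) p = 0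

/-! ## Smooth and Euclidean submanifolds -/

/-- `S` is a smooth (Euclidean `C^∞`) submanifold of codimension `k`. -/
def IsSmoothCodim (k : ℕ) (S : Set (Hpt n)) : Prop :=
  ∀ p ∈ S, ∃ U : Set (Hpt n), IsOpen U ∧ p ∈ U ∧ ∃ f : Fin k → Hpt n → ℝ,
    (∀ i, ContDiff ℝ (⊤ : ℕ∞) (f i)) ∧
    (∀ q ∈ U, LinearIndependent ℝ (fun i => fderiv ℝ (f i) q)) ∧
    S ∩ U = {q ∈ U | ∀ i, f i q = 0}

/-- `S` is a Euclidean `C¹` submanifold of codimension `k`. -/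
def IsC1ECodim (k : ℕ) (S : Set (Hpt n)) : Prop :=
  ∀ p ∈ S, ∃ U : Set (Hpt n), IsOpen U ∧ p ∈ U ∧ ∃ f : Fin k → Hpt n → ℝ,
    (∀ i, ContDiff ℝ 1 (f i)) ∧
    (∀ q ∈ U, LinearIndependent ℝ (fun i => fderiv ℝ (f i) q)) ∧
    S ∩ U = {q ∈ U | ∀ i, f i q = 0}

/-- `M` is a Euclidean `k`-dimensional `C¹` submanifold with boundary (`M` closed in its
charts; boundary charts are half-spaces). -/
def IsC1EuclSubWithBdryDim (k : ℕ) (M : Set (Hpt n)) : Prop :=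
  ∀ p ∈ M, ∃ (V : Set (Fin k → ℝ)) (φ : (Fin k → ℝ) → Hpt n) (U : Set (Hpt n)) (a : Fin k → ℝ)
      (i₀ : Fin k),
    IsOpen V ∧ IsOpen U ∧ p ∈ U ∧ a ∈ V ∧ φ a = p ∧
    ContDiffOn ℝ 1 φ V ∧ Set.InjOn φ V ∧
    (∀ b ∈ V, Function.Injective (fderivWithin ℝ φ V b)) ∧
    (M ∩ U = φ '' (V ∩ {x | 0 ≤ x i₀}) ∨ M ∩ U = φ '' V)

/-! ## Isometries -/

/-- A rotation of the horizontal layer: a linear group automorphism commuting with dilations,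
preserving the vertical coordinate and the horizontal Euclidean norm. -/
def IsRotation (R : Hpt n → Hpt n) : Prop :=
  IsLinearMap ℝ R ∧ (∀ p q, R (hmul p q) = hmul (R p) (R q)) ∧
  (∀ l p, R (hdil l p) = hdil l (R p)) ∧
  (∀ p, (R p).2.2 = p.2.2) ∧
  (∀ p, (∑ j, ((R p).1 j ^ 2 + (R p).2.1 j ^ 2)) = ∑ j, (p.1 j ^ 2 + p.2.1 j ^ 2))

/-- An isometry of `ℍⁿ`: the composition of a left translation and a rotation. -/
def IsHIsom (φ : Hpt n → Hpt n) : Prop :=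
  ∃ (g : Hpt n) (R : Hpt n → Hpt n), IsRotation R ∧ φ = fun p => hmul g (R p)

/-! ## Tangent cones and blow-ups -/

/-- The tangent cone `T^ℍ_0 E` at the origin. -/
def tangentConeH (E : Set (Hpt n)) : Set (Hpt n) :=
  {x | ∃ (xh : ℕ → Hpt n) (rh : ℕ → ℝ), (∀ h, xh h ∈ E) ∧ Tendsto rh atTop atTop ∧
        Tendsto (fun h => hdil (rh h) (xh h)) atTop (𝓝 x)}

/-- The tangent cone `T^ℍ_p E = T^ℍ_0(p⁻¹ ⬝ E)`. -/
def tangentConeHAt (E : Set (Hpt n)) (p : Hpt n) : Set (Hpt n) :=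
  tangentConeH ((fun q => hmul (hinv p) q) '' E)

/-- Local Hausdorff convergence of the sets `F l` to `E` as `l → 0⁺`, with respect to the
homogeneous distance `D`. -/
def LocHausConv (D : HomDist n) (F : ℝ → Set (Hpt n)) (E : Set (Hpt n)) : Prop :=
  ∀ (c : Hpt n) (R ε : ℝ), 0 < R → 0 < ε → ∃ l0 : ℝ, 0 < l0 ∧ ∀ l : ℝ, 0 < l → l < l0 →
    (∀ x ∈ F l ∩ {q | D.d c q ≤ R}, ∃ e ∈ E, D.d x e < ε) ∧
    (∀ x ∈ E ∩ {q | D.d c q ≤ R}, ∃ y ∈ F l, D.d x y < ε)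

/-! ## Induced orientation on the boundary -/

/-- `tB` is the value at `p ∈ ∂S` of the orientation induced on `∂S` by the orientation `tS`
of the `m`-dimensional submanifold with boundary `S`. -/
def InducedBdryOrientAt (D : HomDist n) (m : ℕ) (S : Set (Hpt n)) (p : Hpt n)
    (tS : MVec n m) (tB : MVec n (m-1)) : Prop :=
  if m ≤ n then
    -- low dimension: classical Euclidean induced orientation via the outward normal
    ∃ (νc : Fin (2*n+1) → ℝ) (w : Fin (m-1) → (Fin (2*n+1) → ℝ)) (h : (m-1)+1 = m),
      (∀ i j : Fin ((m-1)+1), dotC (Matrix.vecCons νc w i) (Matrix.vecCons νc w j) = if i = j then 1 else 0) ∧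
      rE νc ∉ tangentConeAt ℝ (closure S) p ∧
      -(rE νc) ∈ tangentConeAt ℝ (closure S) p ∧
      (∀ i, rE (w i) ∈ tangentConeAt ℝ (bdry S) p) ∧
      tB = simpleWedge w ∧ tS = mvCast h (simpleWedge (Matrix.vecCons νc w))
  else if m = n+1 then
    -- critical codimension: `±T ∧ τ_{∂S} = t^ℍ_S` according to whether `S` lies below/above ∂S
    ∃ (U : Set (Hpt n)) (f : Fin n → Hpt n → ℝ), IsOpen U ∧ p ∈ U ∧
      (∀ i, IsC1H U (f i)) ∧ (∀ q ∈ U, LinearIndependent ℝ (fun i => gradH (f i) q)) ∧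
      U ∩ closure S ⊆ {q ∈ U | ∀ i, f i q = 0} ∧
      (∀ r : ℝ, 0 < r →
        (hball D p r ∩ ({q ∈ U | ∀ i, f i q = 0} \ closure S)).Nonempty) ∧
      ∃ (ε : ℝ) (w : Fin (m-1) → (Fin (2*n+1) → ℝ)) (h : (m-1)+1 = m),
        (ε = 1 ∨ ε = -1) ∧
        (∀ i j, dotC (w i) (w j) = if i = j then 1 else 0) ∧
        (∀ i, w i ⟨2*n, by omega⟩ = 0) ∧
        (∀ i, rF (w i) p ∈ tangentConeAt ℝ (bdry S) p) ∧
        -- `ε = −1` iff `S` lies above its boundary around `p`: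
        -- the blow-up of `S` at `p` is the corresponding open half of `T^ℍ_pS`
        LocHausConv D (fun l => (fun q => hdil l⁻¹ (hmul (hinv p) q)) '' S)
          ({v | ∀ i, pansuD (f i) p v = 0} ∩ {q | 0 < (-ε) * q.2.2}) ∧
        tB = simpleWedge (fun i => toEc (rF (w i) p)) ∧
        tS = mvCast h (simpleWedge (Matrix.vecCons (fun j => if (j:ℕ) = 2*n then ε else 0) w))
  else
    -- non-critical low codimension: `ν_{∂S} ∧ t^ℍ_{∂S} = t^ℍ_S` with `ν` the outward normal
    ∃ (U : Set (Hpt n)) (f : Fin (2*n+1-m+1) → Hpt n → ℝ),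
      IsBdryFrame (2*n+1-m) S p U f ∧
      ∃ (νc : Fin (2*n+1) → ℝ) (w : Fin (m-1) → (Fin (2*n+1) → ℝ)) (h : (m-1)+1 = m),
        (∀ i j : Fin ((m-1)+1), dotC (Matrix.vecCons νc w i) (Matrix.vecCons νc w j) = if i = j then 1 else 0) ∧
        (∀ i : Fin (2*n+1-m), pansuD (f i.castSucc) p (rE νc) = 0) ∧
        pansuD (f (Fin.last (2*n+1-m))) p (rE νc) < 0 ∧
        (∀ i, ∀ l : Fin (2*n+1-m+1), pansuD (f l) p (rE (w i)) = 0) ∧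
        tB = simpleWedge w ∧ tS = mvCast h (simpleWedge (Matrix.vecCons νc w))

/-! ## Miscellaneous -/

/-- The projection `π_p(q) = Σⱼ xⱼXⱼ(p) + Σⱼ yⱼYⱼ(p) ∈ H_pℍⁿ`. -/
def piProj (p q : Hpt n) : Hpt n :=
  (∑ j : Fin n, q.1 j • frameVec ⟨(j:ℕ), by omega⟩ p) +
  (∑ j : Fin n, q.2.1 j • frameVec ⟨n + (j:ℕ), by omega⟩ p)

/-- The norm `|·|_p` on the horizontal fibre `H_pℍⁿ` making `X₁(p),…,Yₙ(p)` orthonormal. -/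
def hnormAt (_p : Hpt n) (v : Hpt n) : ℝ :=
  Real.sqrt (∑ j, ((v.1 j) ^ 2 + (v.2.1 j) ^ 2))

/-- The left-invariant scalar product making `X₁,…,Yₙ,T` orthonormal. -/
def dotH (v w : Hpt n) : ℝ :=
  (∑ j, v.1 j * w.1 j) + (∑ j, v.2.1 j * w.2.1 j) + v.2.2 * w.2.2

section Part1
/-! ## Proof, part 1: group and norm -/

/-- The horizontal layer as a Euclidean space. -/
abbrev ZS (n : ℕ) := EuclideanSpace ℝ (Fin n ⊕ Fin n)

/-- Horizontal part. -/
def zz (q : Hpt n) : ZS n := WithLp.toLp 2 (Sum.elim q.1 q.2.1)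

/-- Point from horizontal part and height. -/
def mkH (z : ZS n) (t : ℝ) : Hpt n := (fun i => z (Sum.inl i), fun i => z (Sum.inr i), t)

/-- Half of the symplectic form. -/
def om (z w : ZS n) : ℝ :=
  (∑ j, z (Sum.inl j) * w (Sum.inr j)) / 2 - (∑ j, w (Sum.inl j) * z (Sum.inr j)) / 2

@[simp] lemma zz_inl (q : Hpt n) (i : Fin n) : zz q (Sum.inl i) = q.1 i := rfl
@[simp] lemma zz_inr (q : Hpt n) (i : Fin n) : zz q (Sum.inr i) = q.2.1 i := rfl
@[simp] lemma mkH_t (z : ZS n) (t : ℝ) : (mkH z t).2.2 = t := rfl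
@[simp] lemma zz_mkH (z : ZS n) (t : ℝ) : zz (mkH z t) = z := by
  ext i; rcases i with i | i <;> rfl
@[simp] lemma mkH_zz (q : Hpt n) : mkH (zz q) q.2.2 = q := rfl

lemma mkH_eta (q : Hpt n) : ∃ z t, q = mkH z t := ⟨zz q, q.2.2, rfl⟩

lemma mkH_zero : mkH (0 : ZS n) 0 = 0 := rfl

lemma hmul_mkH (z w : ZS n) (t s : ℝ) :
    hmul (mkH z t) (mkH w s) = mkH (z + w) (t + s + om z w) := by
  simp only [hmul, mkH, om]
  refine Prod.ext rfl (Prod.ext rfl ?_)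
  simp only; ring

lemma hinv_mkH (z : ZS n) (t : ℝ) : hinv (mkH z t) = mkH (-z) (-t) := rfl

lemma hdil_mkH (l : ℝ) (z : ZS n) (t : ℝ) : hdil l (mkH z t) = mkH (l • z) (l ^ 2 * t) := rfl

lemma om_add_left (z w u : ZS n) : om (z + w) u = om z u + om w u := by
  simp only [om, PiLp.add_apply, add_mul, mul_add, Finset.sum_add_distrib]; ring
lemma om_add_right (z w u : ZS n) : om u (z + w) = om u z + om u w := by
  simp only [om, PiLp.add_apply, add_mul, mul_add, Finset.sum_add_distrib]; ring
lemma om_smul_left (l : ℝ) (z w : ZS n) : om (l • z) w = l * om z w := by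
  simp only [om, PiLp.smul_apply, smul_eq_mul, Finset.mul_sum, mul_sub, mul_div_assoc', 
    mul_assoc, mul_left_comm l]
lemma om_smul_right (l : ℝ) (z w : ZS n) : om z (l • w) = l * om z w := by
  simp only [om, PiLp.smul_apply, smul_eq_mul, Finset.mul_sum, mul_sub, mul_div_assoc', 
    mul_assoc, mul_left_comm l]
lemma om_neg_left (z w : ZS n) : om (-z) w = - om z w := by
  have := om_smul_left (-1) z w; simpa using this
lemma om_neg_right (z w : ZS n) : om z (-w) = - om z w := by
  have := om_smul_right (-1) z w; simpa using this
lemma om_self (z : ZS n) : om z z = 0 := by simp [om]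
lemma om_zero_left (z : ZS n) : om 0 z = 0 := by simp [om]
lemma om_zero_right (z : ZS n) : om z 0 = 0 := by simp [om]

lemma continuous_om : Continuous fun x : ZS n × ZS n => om x.1 x.2 := by
  unfold om; fun_prop
lemma continuous_mkH : Continuous fun x : ZS n × ℝ => mkH x.1 x.2 := by
  unfold mkH; fun_prop
lemma continuous_zz : Continuous (zz : Hpt n → ZS n) := by
  unfold zz
  refine (PiLp.continuous_toLp 2 _).comp (continuous_pi ?_)
  rintro (i | i) <;> simp only [Sum.elim_inl, Sum.elim_inr] <;> fun_prop
lemma continuous_hmul : Continuous fun x : Hpt n × Hpt n => hmul x.1 x.2 := by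
  unfold hmul; fun_prop
lemma continuous_hinv : Continuous (hinv : Hpt n → Hpt n) := by
  unfold hinv; fun_prop
lemma continuous_hdil (l : ℝ) : Continuous (hdil l : Hpt n → Hpt n) := by
  unfold hdil; fun_prop

lemma hinv_hmul (p : Hpt n) : hmul (hinv p) p = 0 := by
  obtain ⟨z, t, rfl⟩ := mkH_eta p
  rw [hinv_mkH, hmul_mkH, ← mkH_zero]; congr 1
  · simp
  · rw [om_neg_left, om_self]; ring
lemma hmul_assoc (p q r : Hpt n) : hmul (hmul p q) r = hmul p (hmul q r) := by
  obtain ⟨z, t, rfl⟩ := mkH_eta p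
  obtain ⟨z', t', rfl⟩ := mkH_eta q
  obtain ⟨z'', t'', rfl⟩ := mkH_eta r
  simp only [hmul_mkH, om_add_left, om_add_right]; congr 1
  · abel
  · ring
lemma hmul_zero (p : Hpt n) : hmul p 0 = p := by
  obtain ⟨z, t, rfl⟩ := mkH_eta p
  rw [← mkH_zero, hmul_mkH, om_zero_right]; simp
lemma zero_hmul (p : Hpt n) : hmul 0 p = p := by
  obtain ⟨z, t, rfl⟩ := mkH_eta p
  rw [← mkH_zero, hmul_mkH, om_zero_left]; simp
lemma hmul_hinv (p : Hpt n) : hmul p (hinv p) = 0 := by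
  obtain ⟨z, t, rfl⟩ := mkH_eta p
  rw [hinv_mkH, hmul_mkH, ← mkH_zero]; congr 1
  · simp
  · rw [om_neg_right, om_self]; ring
lemma hmul_hinv_cancel (p q : Hpt n) : hmul p (hmul (hinv p) q) = q := by
  rw [← hmul_assoc, hmul_hinv, zero_hmul]
lemma hinv_hmul_cancel (p q : Hpt n) : hmul (hinv p) (hmul p q) = q := by
  rw [← hmul_assoc, hinv_hmul, zero_hmul]
lemma hdil_hdil (a b : ℝ) (p : Hpt n) : hdil a (hdil b p) = hdil (a * b) p := by
  obtain ⟨z, t, rfl⟩ := mkH_eta p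
  simp only [hdil_mkH, smul_smul]; congr 1; ring
lemma hdil_one (p : Hpt n) : hdil 1 p = p := by
  obtain ⟨z, t, rfl⟩ := mkH_eta p
  simp [hdil_mkH]

namespace HomDist
variable (D : HomDist n)

/-- Homogeneous norm. -/
def nm (q : Hpt n) : ℝ := D.d 0 q

lemma d_self (p : Hpt n) : D.d p p = 0 := (D.eq_iff p p).2 rfl
lemma d_nonneg (p q : Hpt n) : 0 ≤ D.d p q := by
  have := D.triangle p q p
  rw [d_self, D.symm q p] at this; linarith
lemma nm_nonneg (p : Hpt n) : 0 ≤ D.nm p := D.d_nonneg _ _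

lemma d_eq (p q : Hpt n) : D.d p q = D.nm (hmul (hinv p) q) := by
  rw [nm, ← D.leftInv (hinv p) p q, hinv_hmul]

lemma nm_hinv (p : Hpt n) : D.nm (hinv p) = D.nm p := by
  rw [nm, nm, ← D.leftInv p 0 (hinv p), hmul_hinv, hmul_zero, D.symm]

lemma nm_hdil {l : ℝ} (hl : 0 < l) (p : Hpt n) : D.nm (hdil l p) = l * D.nm p := by
  have := D.homog l hl 0 p
  rwa [show hdil l (0 : Hpt n) = 0 by rw [← mkH_zero, hdil_mkH]; simp] at this

lemma nm_congr {z w : ZS n} (h : ‖z‖ = ‖w‖) (t : ℝ) : D.nm (mkH z t) = D.nm (mkH w t) := by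
  refine D.rotInv (mkH z t) (mkH w t) ?_ rfl
  have : ∀ z : ZS n, ∑ j, ((mkH z t).1 j ^ 2 + (mkH z t).2.1 j ^ 2) = ‖z‖ ^ 2 := by
    intro z
    rw [EuclideanSpace.norm_sq_eq, Fintype.sum_sum_type, ← Finset.sum_add_distrib]
    simp [mkH]
  rw [this, this, h]

lemma nm_hmul_le (p q : Hpt n) : D.nm (hmul p q) ≤ D.nm p + D.nm q := by
  have := D.triangle 0 p (hmul p q)
  rwa [D.d_eq p, hinv_hmul_cancel] at this

lemma nm_pos {p : Hpt n} (hp : p ≠ 0) : 0 < D.nm p :=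
  lt_of_le_of_ne (D.nm_nonneg p) fun h => hp ((D.eq_iff 0 p).1 h.symm).symm

lemma nm_zero : D.nm 0 = 0 := D.d_self 0

/-- A horizontal unit vector. -/
def eZ (i : Fin n ⊕ Fin n) : ZS n := EuclideanSpace.single i 1

lemma norm_eZ (i : Fin n ⊕ Fin n) : ‖(eZ i : ZS n)‖ = 1 := by simp [eZ]

/-- The norm as a function of the radius and the height. -/
def NN [NeZero n] (r t : ℝ) : ℝ := D.nm (mkH (r • eZ (Sum.inl 0)) t)

variable [NeZero n]

lemma nm_eq_NN (z : ZS n) (t : ℝ) : D.nm (mkH z t) = D.NN ‖z‖ t :=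
  D.nm_congr (by rw [norm_smul, norm_eZ]; simp) t

lemma NN_neg (r t : ℝ) : D.NN r (-t) = D.NN r t := by
  rw [NN, ← D.nm_hinv, hinv_mkH, neg_neg, NN]
  exact D.nm_congr (by simp) t

lemma NN_scale {l : ℝ} (hl : 0 < l) (r t : ℝ) : D.NN (l * r) (l ^ 2 * t) = l * D.NN r t := by
  rw [NN, NN, ← D.nm_hdil hl, hdil_mkH, smul_smul]

/-- constants -/
def N1 : ℝ := D.NN 1 0
/-- constants -/
def NT : ℝ := D.NN 0 1

lemma N1_pos : 0 < D.N1 := by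
  apply D.nm_pos
  intro h
  have := congrArg (fun q => zz q (Sum.inl 0)) h
  simp [eZ] at this
  
lemma NT_pos : 0 < D.NT := by
  apply D.nm_pos
  intro h
  have := congrArg (fun q => q.2.2) h
  simp at this

lemma NN_r_zero {r : ℝ} (hr : 0 ≤ r) : D.NN r 0 = r * D.N1 := by
  rcases hr.eq_or_lt with rfl | h
  · simp [NN, mkH_zero, nm_zero]
  · rw [N1, ← D.NN_scale h]; simp

lemma NN_zero_t (t : ℝ) : D.NN 0 t = √|t| * D.NT := by
  have key : ∀ t : ℝ, 0 ≤ t → D.NN 0 t = √t * D.NT := by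
    intro t ht
    rcases ht.eq_or_lt with rfl | h
    · simp [NN, mkH_zero, nm_zero]
    · rw [NT, ← D.NN_scale (Real.sqrt_pos.2 h), Real.sq_sqrt h.le]; simp
  rcases le_total 0 t with h | h
  · rw [key t h, abs_of_nonneg h]
  · rw [← D.NN_neg, key (-t) (by linarith), abs_of_nonpos h]

lemma nm_le (z : ZS n) (t : ℝ) : D.nm (mkH z t) ≤ ‖z‖ * D.N1 + √|t| * D.NT := by
  have h := D.nm_hmul_le (mkH z 0) (mkH 0 t)
  rw [hmul_mkH, om_zero_right, D.nm_eq_NN z 0, D.nm_eq_NN 0 t, NN_r_zero _ (norm_nonneg _), norm_zero,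
    NN_zero_t] at h
  simpa using h

lemma norm_le_nm (z : ZS n) (t : ℝ) : ‖z‖ * D.N1 ≤ D.nm (mkH z t) := by
  have h := D.nm_hmul_le (mkH z t) (mkH z (-t))
  rw [hmul_mkH, om_self, D.nm_eq_NN z (-t), NN_neg, ← D.nm_eq_NN, ← two_smul ℝ z, D.nm_eq_NN (2 • z),
    show t + -t + 0 = 0 by ring, NN_r_zero _ (norm_nonneg _), norm_smul] at h
  norm_num at h
  linarith

lemma sqrt_le_nm (z : ZS n) (t : ℝ) : √|t| * D.NT ≤ 2 * D.nm (mkH z t) := by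
  have h := D.nm_hmul_le (mkH z t) (mkH (-z) 0)
  rw [hmul_mkH, om_neg_right, om_self, D.nm_eq_NN (-z), NN_r_zero _ (norm_nonneg _), norm_neg,
    D.nm_eq_NN (z + -z)] at h
  simp only [add_neg_cancel, norm_zero, neg_zero, add_zero, NN_zero_t] at h
  have := D.norm_le_nm z t
  linarith

lemma abs_nm_sub (p q : Hpt n) : |D.nm p - D.nm q| ≤ D.nm (hmul (hinv p) q) := by
  rw [← D.d_eq, abs_le]
  have h1 := D.triangle 0 p q
  have h2 := D.triangle 0 q p
  rw [D.symm q p] at h2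
  unfold nm
  constructor <;> linarith

lemma tendsto_nm_zero : Tendsto D.nm (𝓝 0) (𝓝 0) := by
  have h : Tendsto (fun q : Hpt n => ‖zz q‖ * D.N1 + √|q.2.2| * D.NT) (𝓝 0) (𝓝 0) := by
    have hc : Continuous (fun q : Hpt n => ‖zz q‖ * D.N1 + √|q.2.2| * D.NT) := by
      have := continuous_zz (n := n)
      fun_prop
    have := hc.tendsto 0
    rw [show (zz (0 : Hpt n)) = 0 by rw [← mkH_zero, zz_mkH]] at this
    simpa using this
  exact squeeze_zero (fun q => D.nm_nonneg q) (fun q => D.nm_le (zz q) q.2.2) h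

lemma continuous_nm : Continuous D.nm := by
  rw [continuous_iff_continuousAt]
  intro p
  rw [ContinuousAt, tendsto_iff_dist_tendsto_zero]
  have h : Tendsto (fun q => D.nm (hmul (hinv p) q)) (𝓝 p) (𝓝 0) := by
    apply D.tendsto_nm_zero.comp
    have hc : Continuous (fun q => hmul (hinv p) q) := 
      continuous_hmul.comp (continuous_const.prodMk continuous_id)
    have := hc.tendsto p
    rwa [hinv_hmul] at this
  refine squeeze_zero (fun _ => dist_nonneg) (fun q => ?_) h
  rw [Real.dist_eq, abs_sub_comm]
  exact D.abs_nm_sub p q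

lemma continuous_d : Continuous fun x : Hpt n × Hpt n => D.d x.1 x.2 := by
  simp_rw [D.d_eq]
  exact D.continuous_nm.comp (continuous_hmul.comp
    ((continuous_hinv.comp continuous_fst).prodMk continuous_snd))

lemma continuous_NN : Continuous fun x : ℝ × ℝ => D.NN x.1 x.2 := by
  unfold NN
  refine D.continuous_nm.comp (continuous_mkH.comp (.prodMk ?_ ?_)) <;> fun_prop

lemma isOpen_ball (p : Hpt n) (r : ℝ) : IsOpen (rawBall D.d p r) :=
  isOpen_lt (D.continuous_d.comp (continuous_const.prodMk continuous_id)) continuous_const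

lemma isClosed_cball (p : Hpt n) (r : ℝ) : IsClosed {q | D.d p q ≤ r} :=
  isClosed_le (D.continuous_d.comp (continuous_const.prodMk continuous_id)) continuous_const

lemma isCompact_cball0 (r : ℝ) : IsCompact {q | D.d 0 q ≤ r} := by
  have hK : IsCompact ((fun x : ZS n × ℝ => mkH x.1 x.2) ''
      (Metric.closedBall 0 (r / D.N1) ×ˢ Metric.closedBall 0 ((2 * r / D.NT) ^ 2))) :=
    ((isCompact_closedBall _ _).prod (isCompact_closedBall _ _)).image continuous_mkH
  refine hK.of_isClosed_subset (D.isClosed_cball _ _) ?_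
  intro q hq
  obtain ⟨z, t, rfl⟩ := mkH_eta q
  refine ⟨(z, t), ⟨?_, ?_⟩, rfl⟩
  · have := D.norm_le_nm z t
    simp only [mem_closedBall_zero_iff]
    rw [le_div_iff₀ D.N1_pos]
    exact this.trans hq
  · have h := D.sqrt_le_nm z t
    simp only [mem_closedBall_zero_iff, Real.norm_eq_abs]
    have h2 : √|t| ≤ 2 * r / D.NT := by
      rw [le_div_iff₀ D.NT_pos]
      have : D.nm (mkH z t) ≤ r := hq
      linarith
    calc |t| = √|t| ^ 2 := (Real.sq_sqrt (abs_nonneg _)).symm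
      _ ≤ _ := by gcongr

/-- balls form a neighbourhood basis -/
lemma hasBasis_nhds (p : Hpt n) : (𝓝 p).HasBasis (fun ε : ℝ => 0 < ε) (fun ε => rawBall D.d p ε) := by
  refine ⟨fun s => ⟨fun hs => ?_, fun ⟨ε, hε, h⟩ => ?_⟩⟩
  · -- squeeze
    by_contra hcon
    push Not at hcon
    have hx : ∀ j : ℕ, ∃ q, D.d p q < 1 / ((j : ℝ) + 1) ∧ q ∉ s := by
      intro j
      have := hcon (1 / ((j : ℝ) + 1)) (by positivity)
      rw [Set.not_subset] at this
      exact this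
    choose q hq1 hq2 using hx
    have hnm : Tendsto (fun j => D.nm (hmul (hinv p) (q j))) atTop (𝓝 0) := by
      refine squeeze_zero (fun _ => D.nm_nonneg _) (fun j => ?_) tendsto_one_div_add_atTop_nhds_zero_nat
      rw [← D.d_eq]; exact (hq1 j).le
    have hz : Tendsto (fun j => zz (hmul (hinv p) (q j))) atTop (𝓝 0) := by
      rw [tendsto_zero_iff_norm_tendsto_zero]
      refine squeeze_zero (fun _ => norm_nonneg _) (fun j => ?_) 
        (by simpa using hnm.div_const D.N1)
      rw [le_div_iff₀ D.N1_pos]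
      exact D.norm_le_nm (zz (hmul (hinv p) (q j))) (hmul (hinv p) (q j)).2.2
    have ht : Tendsto (fun j => (hmul (hinv p) (q j)).2.2) atTop (𝓝 0) := by
      rw [tendsto_zero_iff_norm_tendsto_zero]
      refine squeeze_zero (fun _ => norm_nonneg _) (fun j => ?_) 
        (by simpa using ((hnm.const_mul 2).div_const D.NT).pow 2)
      have h := D.sqrt_le_nm (zz (hmul (hinv p) (q j))) (hmul (hinv p) (q j)).2.2
      rw [mkH_zz, ← le_div_iff₀ D.NT_pos] at h
      rw [Real.norm_eq_abs]
      calc |(hmul (hinv p) (q j)).2.2| = √|(hmul (hinv p) (q j)).2.2| ^ 2 := 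
            (Real.sq_sqrt (abs_nonneg _)).symm
        _ ≤ _ := by gcongr
    have h0 : Tendsto (fun j => hmul (hinv p) (q j)) atTop (𝓝 0) := by
      have := (continuous_mkH.tendsto ((0 : ZS n), (0 : ℝ))).comp (hz.prodMk_nhds ht)
      exact this
    have h1 : Tendsto q atTop (𝓝 p) := by
      have hc : Continuous (fun q => hmul p q) := 
        continuous_hmul.comp (continuous_const.prodMk continuous_id)
      have := (hc.tendsto 0).comp h0
      rw [hmul_zero] at this
      refine this.congr fun j => ?_
      simp [hmul_hinv_cancel]
    obtain ⟨j, hj⟩ := (h1.eventually hs).exists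
    exact hq2 j hj
  · refine Filter.mem_of_superset ((D.isOpen_ball p ε).mem_nhds ?_) h
    simp [rawBall, d_self, hε]

end HomDist

end Part1

section Part2
set_option linter.unusedSectionVars false

/-! ## Proof, part 2: Lebesgue measure on vertical subgroups -/

section vert
variable {E : Type} [NormedAddCommGroup E] [InnerProductSpace ℝ E] [FiniteDimensional ℝ E]
  [MeasurableSpace E] [BorelSpace E]

/-- parametrization of a vertical subgroup -/
def vpar (ι : E →ₗᵢ[ℝ] ZS n) (x : E × ℝ) : Hpt n := mkH (ι x.1) x.2

/-- Lebesgue measure on a vertical subgroup -/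
def Hm (ι : E →ₗᵢ[ℝ] ZS n) : Measure (Hpt n) :=
  Measure.map (vpar ι) ((volume : Measure E).prod (volume : Measure ℝ))

lemma continuous_vpar (ι : E →ₗᵢ[ℝ] ZS n) : Continuous (vpar ι) :=
  continuous_mkH.comp ((ι.continuous.comp continuous_fst).prodMk continuous_snd)

/-- adjoint -/
def iadj (ι : E →ₗᵢ[ℝ] ZS n) : ZS n →L[ℝ] E :=
  ContinuousLinearMap.adjoint ι.toContinuousLinearMap

lemma inner_iadj (ι : E →ₗᵢ[ℝ] ZS n) (v : E) (z : ZS n) :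
    inner ℝ v (iadj ι z) = inner ℝ (ι v) z := by
  rw [iadj, ContinuousLinearMap.adjoint_inner_right]; rfl

/-- distance from the vertical subgroup -/
def aperp (ι : E →ₗᵢ[ℝ] ZS n) (z : ZS n) : ℝ := ‖z - ι (iadj ι z)‖

lemma norm_sub_sq_perp (ι : E →ₗᵢ[ℝ] ZS n) (v : E) (z : ZS n) :
    ‖-z + ι v‖ = √(‖v - iadj ι z‖ ^ 2 + aperp ι z ^ 2) := by
  symm
  rw [Real.sqrt_eq_iff_mul_self_eq (by positivity) (by positivity)]
  have h : -z + ι v = ι (v - iadj ι z) - (z - ι (iadj ι z)) := by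
    rw [map_sub]; abel
  have horth : inner ℝ (ι (v - iadj ι z)) (z - ι (iadj ι z)) = 0 := by
    rw [inner_sub_right, ← inner_iadj, LinearIsometry.inner_map_map, sub_self]
  rw [h, norm_sub_mul_self_real, horth, LinearIsometry.norm_map, aperp]
  ring

variable [NeZero n] (D : HomDist n)

/-- Volume of slices -/
def Psi (E : Type) [NormedAddCommGroup E] [InnerProductSpace ℝ E] [FiniteDimensional ℝ E]
    [MeasurableSpace E] [BorelSpace E] (D : HomDist n) (a : ℝ) (A : Set ℝ) : ℝ≥0∞ :=
  ((volume : Measure E).prod (volume : Measure ℝ)) {x | D.NN √(‖x.1‖ ^ 2 + a ^ 2) x.2 ∈ A}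

lemma continuous_Psi_fun (a : ℝ) :
    Continuous fun x : E × ℝ => D.NN √(‖x.1‖ ^ 2 + a ^ 2) x.2 :=
  D.continuous_NN.comp (.prodMk (by fun_prop) (by fun_prop))

lemma Hm_eq_Psi (ι : E →ₗᵢ[ℝ] ZS n) (p : Hpt n) {A : Set ℝ} (hA : MeasurableSet A) :
    Hm ι {q | D.d p q ∈ A} = Psi E D (aperp ι (zz p)) A := by
  have hc : Continuous fun q => D.d p q := D.continuous_d.comp (continuous_const.prodMk continuous_id)
  have hms : MeasurableSet {q | D.d p q ∈ A} := hc.measurable hA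
  rw [Hm, Measure.map_apply (continuous_vpar ι).measurable hms, Psi]
  have hmp : MeasurePreserving (fun x : E × ℝ => (x.1 - iadj ι (zz p), 
      x.2 + (- p.2.2 + om (-zz p) (ι x.1)))) 
      ((volume : Measure E).prod (volume : Measure ℝ)) 
      ((volume : Measure E).prod (volume : Measure ℝ)) := by
    refine MeasurePreserving.skew_product (f := fun v => v - iadj ι (zz p)) 
      (g := fun v s => s + (- p.2.2 + om (-zz p) (ι v)))
      (measurePreserving_sub_right _ _) ?_ ?_
    · have h1 : Continuous fun v : E => om (-zz p) (ι v) := 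
        continuous_om.comp (continuous_const.prodMk ι.continuous)
      apply Continuous.measurable
      unfold Function.uncurry
      have := h1.comp (continuous_fst (X := E) (Y := ℝ))
      simp only [Function.comp_def] at this
      fun_prop
    · refine Eventually.of_forall fun v => ?_
      exact (measurePreserving_add_right volume _).map_eq
  have hT : MeasurableSet {x : E × ℝ | D.NN √(‖x.1‖ ^ 2 + aperp ι (zz p) ^ 2) x.2 ∈ A} :=
    (continuous_Psi_fun D _).measurable hA
  rw [← hmp.measure_preimage hT.nullMeasurableSet]
  · congr 1
    ext x
    simp only [mem_preimage, mem_ofPred_eq]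
    rw [D.d_eq]
    nth_rewrite 1 [← mkH_zz p]
    rw [hinv_mkH, vpar, hmul_mkH, D.nm_eq_NN, norm_sub_sq_perp]
    rw [show -p.2.2 + x.2 + om (-zz p) (ι x.1) = x.2 + (-p.2.2 + om (-zz p) (ι x.1)) by ring]

lemma Psi_scale {l : ℝ} (hl : 0 < l) (a : ℝ) {A : Set ℝ} (hA : MeasurableSet A) :
    Psi E D (l * a) {y | l⁻¹ * y ∈ A} = 
      ENNReal.ofReal (l ^ (Module.finrank ℝ E + 2)) * Psi E D a A := by
  have hmap : Measure.map (Prod.map (fun v : E => l • v) (fun s : ℝ => (l ^ 2) • s))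
      ((volume : Measure E).prod (volume : Measure ℝ)) = 
      ENNReal.ofReal ((l ^ (Module.finrank ℝ E + 2))⁻¹) • 
        ((volume : Measure E).prod (volume : Measure ℝ)) := by
    rw [← Measure.map_prod_map _ _ (by fun_prop) (by fun_prop), 
      Measure.map_addHaar_smul volume hl.ne', Measure.map_addHaar_smul volume (by positivity)]
    rw [Measure.prod_smul_left, Measure.prod_smul_right, smul_smul, 
      ← ENNReal.ofReal_mul (by positivity)]
    congr 2
    rw [abs_of_pos (by positivity), abs_of_pos (by positivity), pow_add]
    simp
    ring
  have hB : MeasurableSet {y : ℝ | l⁻¹ * y ∈ A} := (measurable_const_mul l⁻¹) hA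
  have hT := (continuous_Psi_fun (E := E) D (l * a)).measurable hB
  have h2 := congrArg (fun μ => μ ((fun x : E × ℝ => D.NN √(‖x.1‖ ^ 2 + (l * a) ^ 2) x.2) ⁻¹' 
    {y : ℝ | l⁻¹ * y ∈ A})) hmap
  rw [Measure.map_apply (by fun_prop) hT, Measure.smul_apply, smul_eq_mul] at h2
  have h3 : Prod.map (fun v : E => l • v) (fun s : ℝ => (l ^ 2) • s) ⁻¹' 
      ((fun x : E × ℝ => D.NN √(‖x.1‖ ^ 2 + (l * a) ^ 2) x.2) ⁻¹' {y : ℝ | l⁻¹ * y ∈ A}) =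
      {x : E × ℝ | D.NN √(‖x.1‖ ^ 2 + a ^ 2) x.2 ∈ A} := by
    ext x
    simp only [mem_preimage, mem_ofPred_eq, Prod.map_fst, Prod.map_snd, norm_smul, smul_eq_mul]
    have : √((‖l‖ * ‖x.1‖) ^ 2 + (l * a) ^ 2) = l * √(‖x.1‖ ^ 2 + a ^ 2) := by
      rw [Real.norm_of_nonneg hl.le, mul_pow, mul_pow, ← mul_add, Real.sqrt_mul (by positivity), 
        Real.sqrt_sq hl.le]
    rw [this, D.NN_scale hl, inv_mul_cancel_left₀ hl.ne']
  rw [h3] at h2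
  unfold Psi
  rw [h2, ← mul_assoc, ← ENNReal.ofReal_mul (by positivity), mul_inv_cancel₀ (by positivity)]
  simp

lemma Psi_scale_Iic {l : ℝ} (hl : 0 < l) (a r : ℝ)  :
    Psi E D (l * a) (Iic (l * r)) = 
      ENNReal.ofReal (l ^ (Module.finrank ℝ E + 2)) * Psi E D a (Iic r) := by
  rw [← Psi_scale D hl a measurableSet_Iic]
  congr 1; ext y
  simp [inv_mul_le_iff₀ hl]

lemma Psi_scale_Iio {l : ℝ} (hl : 0 < l) (a r : ℝ)  :
    Psi E D (l * a) (Iio (l * r)) = 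
      ENNReal.ofReal (l ^ (Module.finrank ℝ E + 2)) * Psi E D a (Iio r) := by
  rw [← Psi_scale D hl a measurableSet_Iio]
  congr 1; ext y
  simp [inv_mul_lt_iff₀ hl]

lemma Psi_mono (a : ℝ) {A B : Set ℝ} (h : A ⊆ B) : Psi E D a A ≤ Psi E D a B := 
  measure_mono fun _ hx => h hx

lemma Psi_le_bound (a : ℝ) : Psi E D a (Iic 1) ≤ ((volume : Measure E).prod (volume : Measure ℝ))
    (Metric.closedBall 0 (1 / D.N1) ×ˢ Metric.closedBall 0 ((2 / D.NT) ^ 2)) := by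
  refine measure_mono ?_
  rintro ⟨v, t⟩ hx
  simp only [mem_ofPred_eq, mem_Iic] at hx
  set r := √(‖v‖ ^ 2 + a ^ 2)
  have hr : 0 ≤ r := Real.sqrt_nonneg _
  have hnr : ‖r • (HomDist.eZ (Sum.inl 0) : ZS n)‖ = r := by
    rw [norm_smul, HomDist.norm_eZ, mul_one, Real.norm_of_nonneg hr]
  have h1 := D.norm_le_nm (r • HomDist.eZ (Sum.inl 0)) t
  have h2 := D.sqrt_le_nm (r • HomDist.eZ (Sum.inl 0)) t
  rw [D.nm_eq_NN, hnr] at h1 h2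
  refine ⟨?_, ?_⟩
  · simp only [mem_closedBall_zero_iff]
    rw [le_div_iff₀ D.N1_pos]
    have : ‖v‖ ≤ r := Real.le_sqrt_of_sq_le (by nlinarith [sq_nonneg a])
    have := mul_le_mul_of_nonneg_right this D.N1_pos.le
    linarith
  · simp only [mem_closedBall_zero_iff, Real.norm_eq_abs]
    have h2 : √|t| ≤ 2 / D.NT := by
      rw [le_div_iff₀ D.NT_pos]
      linarith
    calc |t| = √|t| ^ 2 := (Real.sq_sqrt (abs_nonneg _)).symm
      _ ≤ _ := by gcongr

lemma bound_lt_top : ((volume : Measure E).prod (volume : Measure ℝ))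
    (Metric.closedBall 0 (1 / D.N1) ×ˢ Metric.closedBall 0 ((2 / D.NT) ^ 2)) < ⊤ :=
  ((isCompact_closedBall _ _).prod (isCompact_closedBall _ _)).measure_lt_top

lemma Psi_lt_top (a : ℝ) : Psi E D a (Iic 1) < ⊤ := (Psi_le_bound D a).trans_lt (bound_lt_top D)

lemma Psi_zero_pos : 0 < Psi E D 0 (Iio 1) := by
  refine IsOpen.measure_pos _ (isOpen_Iio.preimage (continuous_Psi_fun D 0)) ⟨0, ?_⟩
  simp [D.NN_zero_t]

instance instLFHm (ι : E →ₗᵢ[ℝ] ZS n) [Nonempty (HomDist n)] : IsLocallyFiniteMeasure (Hm ι) := by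
  let D : HomDist n := Classical.arbitrary _
  refine ⟨fun p => ⟨{q | D.d p q ∈ Iio 1}, ?_, ?_⟩⟩
  · exact (D.isOpen_ball p 1).mem_nhds (by simp [rawBall, D.d_self])
  · rw [Hm_eq_Psi D ι p measurableSet_Iio]
    exact (Psi_mono D _ Iio_subset_Iic_self).trans_lt (Psi_lt_top D _)

lemma Hm_range_compl (ι : E →ₗᵢ[ℝ] ZS n) : Hm ι (range (vpar ι))ᶜ = 0 := by
  have hcl : IsClosed (range (vpar ι)) := by
    have : range (vpar ι) = {q | zz q ∈ (LinearMap.range ι.toLinearMap : Set (ZS n))} := by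
      ext q; constructor
      · rintro ⟨x, rfl⟩; simp [vpar]
      · rintro ⟨v, hv⟩
        refine ⟨(v, q.2.2), ?_⟩
        have hv : ι v = zz q := hv
        simp [vpar, hv]
    rw [this]
    exact (Submodule.closed_of_finiteDimensional _).preimage continuous_zz
  rw [Hm, Measure.map_apply (continuous_vpar ι).measurable hcl.measurableSet.compl]
  have : vpar ι ⁻¹' (range (vpar ι))ᶜ = ∅ := by ext x; simp
  rw [this, measure_empty]

end vert

/-! Standard parameter space -/

/-- The standard parameter space. -/
abbrev E0 (n k : ℕ) := EuclideanSpace ℝ ({i : Fin n // k ≤ (i : ℕ)} ⊕ Fin n)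

lemma finrank_E0 {k : ℕ} (hk : k ≤ n) : Module.finrank ℝ (E0 n k) = 2 * n - k := by
  rw [finrank_euclideanSpace, Fintype.card_sum, Fintype.card_fin]
  have : Fintype.card {i : Fin n // k ≤ (i : ℕ)} = n - k := by
    have h := Fintype.card_subtype_compl (fun i : Fin n => (i : ℕ) < k)
    simp only [not_lt, Fintype.card_fin] at h
    rw [h, Fintype.card_subtype]
    congr 1
    have : (Finset.univ.filter fun i : Fin n => (i : ℕ) < k).card = min n k := by
      rw [Fin.card_filter_val_lt]
    omega
  omega

/-- linear part -/
def iota0L (n k : ℕ) : E0 n k →ₗ[ℝ] ZS n where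
  toFun v := WithLp.toLp 2 (Sum.elim (fun i => if h : k ≤ (i:ℕ) then v (Sum.inl ⟨i, h⟩) else 0)
    (fun i => v (Sum.inr i)))
  map_add' v w := by
    ext i; rcases i with i | i
    · by_cases h : k ≤ (i : ℕ) <;> simp [h]
    · simp
  map_smul' c v := by
    ext i; rcases i with i | i
    · by_cases h : k ≤ (i : ℕ) <;> simp [h]
    · simp

/-- standard isometry -/
def iota0 (n k : ℕ) : E0 n k →ₗᵢ[ℝ] ZS n where
  toLinearMap := iota0L n k
  norm_map' v := by
    rw [EuclideanSpace.norm_eq, EuclideanSpace.norm_eq]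
    congr 1
    rw [Fintype.sum_sum_type, Fintype.sum_sum_type]
    congr 1
    simp only [iota0L, LinearMap.coe_mk, AddHom.coe_mk, Sum.elim_inl]
    have : ∀ i : Fin n, ‖(if h : k ≤ (i:ℕ) then v (Sum.inl ⟨i, h⟩) else 0)‖ ^ 2 = 
      if h : k ≤ (i:ℕ) then ‖v (Sum.inl ⟨i, h⟩)‖ ^ 2 else 0 := by
      intro i; split_ifs <;> simp
    simp_rw [this]
    rw [Finset.sum_dite]
    simp only [Finset.sum_const_zero, add_zero]
    symm
    refine Finset.sum_bij (fun a _ => ⟨a.1, by simp [a.2]⟩) ?_ ?_ ?_ ?_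
    · simp
    · intro a _ b _ h; simpa [Subtype.ext_iff] using h
    · rintro ⟨b, hb⟩ _
      simp at hb
      exact ⟨⟨b, hb⟩, by simp, rfl⟩
    · intro a _; rfl

lemma wLeb_eq (n k : ℕ) : wLeb n k = Hm (iota0 n k) := by
  have h1 : MeasurePreserving (fun x : E0 n k => MeasurableEquiv.sumPiEquivProdPi (fun _ => ℝ) x.ofLp)
      volume (volume.prod volume) := 
    (volume_measurePreserving_sumPiEquivProdPi (fun _ => ℝ)).comp 
      (PiLp.volume_preserving_ofLp _)
  have h2 := (measurePreserving_prodAssoc (volume : Measure ({i : Fin n // k ≤ (i : ℕ)} → ℝ)) 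
    (volume : Measure (Fin n → ℝ)) (volume : Measure ℝ)).comp 
      (h1.prod (MeasurePreserving.id (volume : Measure ℝ)))
  have hw : Measurable (wEmbed n k) := by
    unfold wEmbed
    refine Measurable.prodMk (measurable_pi_lambda _ fun i => ?_) (by fun_prop)
    split_ifs <;> fun_prop
  have hvol : (volume : Measure (({i : Fin n // k ≤ (i : ℕ)} → ℝ) × (Fin n → ℝ) × ℝ)) =
    volume.prod (volume.prod volume) := rfl
  rw [wLeb, hvol, ← h2.map_eq, Measure.map_map hw h2.measurable, Hm]
  congr 1

section beta
variable [NeZero n] (D : HomDist n) (k : ℕ)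

/-- The supremum appearing in the geometric constant. -/
def beta : ℝ := sSup {v : ℝ | ∃ p ∈ hball D 0 1, v = (wLeb n k (Wstd n k ∩ hball D p 1)).toReal}

lemma wLeb_ball (p : Hpt n) : wLeb n k (Wstd n k ∩ hball D p 1) = 
    Psi (E0 n k) D (aperp (iota0 n k) (zz p)) (Iio 1) := by
  rw [← Hm_eq_Psi D _ p measurableSet_Iio, wLeb_eq]
  apply measure_congr
  have : Hm (iota0 n k) (Wstd n k)ᶜ = 0 := by
    refine measure_mono_null ?_ (Hm_range_compl (iota0 n k))
    rw [compl_subset_compl]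
    rintro _ ⟨x, rfl⟩ i hi
    simp [vpar, mkH, iota0, iota0L, hi]
  have h2 : Wstd n k =ᵐ[Hm (iota0 n k)] univ := by
    rwa [ae_eq_univ]
  have h3 := h2.inter (ae_eq_refl (hball D p 1))
  rw [univ_inter] at h3
  exact h3

lemma beta_bdd : BddAbove {v : ℝ | ∃ p ∈ hball D 0 1, v = (wLeb n k (Wstd n k ∩ hball D p 1)).toReal} := by
  refine ⟨(((volume : Measure (E0 n k)).prod (volume : Measure ℝ))
    (Metric.closedBall 0 (1 / D.N1) ×ˢ Metric.closedBall 0 ((2 / D.NT) ^ 2))).toReal, ?_⟩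
  rintro _ ⟨p, _, rfl⟩
  rw [wLeb_ball]
  refine ENNReal.toReal_mono (bound_lt_top D).ne ?_
  exact (Psi_mono D _ Iio_subset_Iic_self).trans (Psi_le_bound D _)

/-- existence of perpendicular vectors -/
lemma exists_perp {k : ℕ} (hk1 : 1 ≤ k) (hk : k ≤ n) (ι : E0 n k →ₗᵢ[ℝ] ZS n) {a : ℝ} (ha : 0 ≤ a) :
    ∃ z : ZS n, aperp ι z = a ∧ ‖z‖ = a := by
  have hne : (LinearMap.range ι.toLinearMap)ᗮ ≠ ⊥ := by
    rw [Ne, Submodule.orthogonal_eq_bot_iff]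
    intro h
    have h1 := LinearMap.finrank_range_of_inj (f := ι.toLinearMap) ι.injective
    rw [h, finrank_top, finrank_E0 hk, finrank_euclideanSpace] at h1
    simp at h1
    have := NeZero.pos n
    omega
  obtain ⟨z, hz, hz0⟩ := Submodule.exists_mem_ne_zero_of_ne_bot hne
  have hadj : iadj ι z = 0 := by
    rw [← inner_self_eq_zero (𝕜 := ℝ), inner_iadj]
    exact (Submodule.mem_orthogonal _ _).1 hz _ ⟨_, rfl⟩
  refine ⟨(a / ‖z‖) • z, ?_, ?_⟩
  · rw [aperp, map_smul, hadj, smul_zero, map_zero, sub_zero, norm_smul, Real.norm_of_nonneg (by positivity)]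
    have := norm_pos_iff.2 hz0
    field_simp
  · rw [norm_smul, Real.norm_of_nonneg (by positivity)]
    have := norm_pos_iff.2 hz0
    field_simp

variable {k}

lemma Psi_le_beta (hk1 : 1 ≤ k) (hk : k ≤ n) {a : ℝ} (ha : 0 ≤ a) : 
    Psi (E0 n k) D a (Iio 1) ≤ ENNReal.ofReal (beta D k) := by
  by_cases h0 : Psi (E0 n k) D a (Iio 1) = 0
  · rw [h0]; exact zero_le
  have hne : {x : E0 n k × ℝ | D.NN √(‖x.1‖ ^ 2 + a ^ 2) x.2 ∈ Iio 1}.Nonempty := by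
    rw [nonempty_iff_ne_empty]; intro h
    apply h0; rw [Psi, h, measure_empty]
  obtain ⟨⟨v, t⟩, hx⟩ := hne
  simp only [mem_ofPred_eq, mem_Iio] at hx
  obtain ⟨z, hz, hza⟩ := exists_perp hk1 hk (iota0 n k) ha
  have hfin : Psi (E0 n k) D a (Iio 1) ≠ ⊤ := 
    ((Psi_mono D _ Iio_subset_Iic_self).trans_lt (Psi_lt_top D _)).ne
  rw [← ENNReal.ofReal_toReal hfin]
  apply ENNReal.ofReal_le_ofReal
  refine le_csSup (beta_bdd D k) ⟨mkH z 0, ?_, ?_⟩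
  · change D.nm (mkH z 0) < 1
    rw [D.nm_eq_NN, hza, D.NN_r_zero ha]
    set r := √(‖v‖ ^ 2 + a ^ 2)
    have hr : 0 ≤ r := Real.sqrt_nonneg _
    have hnr : ‖r • (HomDist.eZ (Sum.inl 0) : ZS n)‖ = r := by
      rw [norm_smul, HomDist.norm_eZ, mul_one, Real.norm_of_nonneg hr]
    have h1 := D.norm_le_nm (r • HomDist.eZ (Sum.inl 0)) t
    rw [D.nm_eq_NN, hnr] at h1
    have : a ≤ r := Real.le_sqrt_of_sq_le (by nlinarith [sq_nonneg ‖v‖])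
    have := mul_le_mul_of_nonneg_right this D.N1_pos.le
    linarith
  · rw [wLeb_ball, zz_mkH, hz]

lemma beta_pos (hk1 : 1 ≤ k) (hk : k ≤ n) : 0 < beta D k := by
  have := (Psi_zero_pos (E := E0 n k) D).trans_le (Psi_le_beta D hk1 hk le_rfl)
  simpa using this

lemma exists_lt_beta {b : ℝ} (hb : b < beta D k) : 
    ∃ a : ℝ, 0 ≤ a ∧ ENNReal.ofReal b ≤ Psi (E0 n k) D a (Iic 1) := by
  obtain ⟨_, ⟨p, hp, rfl⟩, h⟩ := exists_lt_of_lt_csSup (s := {v : ℝ | ∃ p ∈ hball D 0 1, v = (wLeb n k (Wstd n k ∩ hball D p 1)).toReal})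
    ⟨_, 0, by simp [hball, rawBall, D.d_self], rfl⟩ hb
  rw [wLeb_ball] at h
  refine ⟨aperp (iota0 n k) (zz p), norm_nonneg _, ?_⟩
  refine le_trans ?_ (Psi_mono D _ Iio_subset_Iic_self)
  exact ENNReal.ofReal_le_of_le_toReal h.le

lemma Psi_Iic_le_beta (hk1 : 1 ≤ k) (hk : k ≤ n) {a : ℝ} (ha : 0 ≤ a) : 
    Psi (E0 n k) D a (Iic 1) ≤ ENNReal.ofReal (beta D k) := by
  have hlim : Tendsto (fun l : ℝ => ENNReal.ofReal (l ^ (Module.finrank ℝ (E0 n k) + 2) * beta D k)) 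
      (𝓝[>] 1) (𝓝 (ENNReal.ofReal (beta D k))) := by
    have hc : Continuous (fun l : ℝ => ENNReal.ofReal (l ^ (Module.finrank ℝ (E0 n k) + 2) * beta D k)) :=
      ENNReal.continuous_ofReal.comp (by fun_prop)
    have := (hc.tendsto 1).mono_left (nhdsWithin_le_nhds (s := Ioi 1))
    simpa using this
  refine ge_of_tendsto hlim ?_
  filter_upwards [self_mem_nhdsWithin] with l hl
  have hl : 1 < l := hl
  have hl0 : 0 < l := by linarith
  have h1 : Psi (E0 n k) D a (Iic 1) ≤ Psi (E0 n k) D (l * (l⁻¹ * a)) (Iio (l * 1)) := by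
    rw [mul_inv_cancel_left₀ hl0.ne', mul_one]
    exact Psi_mono D _ (Iic_subset_Iio.2 hl)
  refine h1.trans ?_
  rw [Psi_scale_Iio D hl0, ENNReal.ofReal_mul (by positivity)]
  gcongr
  exact Psi_le_beta D hk1 hk (by positivity)

end beta

end Part2

section Part3
set_option linter.unusedSectionVars false

/-! ## Proof, part 3: spherical premeasures -/

lemma sphPre_ball_le {d : Hpt n → Hpt n → ℝ} {m r : ℝ} {c : Hpt n} {ρ : ℝ} (h0 : 0 < ρ) (h1 : ρ < r)
    {s : Set (Hpt n)} (hs : s ⊆ rawBall d c ρ) : sphPre d m r s ≤ ENNReal.ofReal ((2*ρ) ^ m) := by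
  refine (OuterMeasure.boundedBy_le s).trans ?_
  exact iInf_le_of_le c (iInf_le_of_le ρ (iInf_le_of_le h0 (iInf_le_of_le h1 (iInf_le_of_le hs le_rfl))))

lemma sphGauge_anti (d : Hpt n → Hpt n → ℝ) (m : ℝ) {r r' : ℝ} (h : r ≤ r') (s : Set (Hpt n)) :
    sphGauge d m r' s ≤ sphGauge d m r s := by
  refine le_iInf fun c => le_iInf fun ρ => le_iInf fun h0 => le_iInf fun h1 => le_iInf fun hs => ?_
  exact iInf_le_of_le c (iInf_le_of_le ρ (iInf_le_of_le h0 (iInf_le_of_le (h1.trans_le h) 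
    (iInf_le_of_le hs le_rfl))))

lemma sphPre_anti (d : Hpt n → Hpt n → ℝ) (m : ℝ) {r r' : ℝ} (h : r ≤ r') (s : Set (Hpt n)) :
    sphPre d m r' s ≤ sphPre d m r s := by
  have : sphPre d m r' ≤ sphPre d m r := by
    unfold sphPre
    rw [OuterMeasure.le_boundedBy]
    intro s
    exact (OuterMeasure.boundedBy_le s).trans (sphGauge_anti d m h s)
  exact this s

lemma sphPre_open [NeZero n] (D : HomDist n) (m r : ℝ) (A : Set (Hpt n)) {ε : ℝ≥0∞} (hε : ε ≠ 0) :
    ∃ G, IsOpen G ∧ A ⊆ G ∧ sphPre D.d m r G ≤ sphPre D.d m r A + ε := by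
  by_cases htop : sphPre D.d m r A = ⊤
  · exact ⟨univ, isOpen_univ, subset_univ _, by simp [htop]⟩
  have hε2 : ε / 2 ≠ 0 := (ENNReal.half_pos hε).ne'
  have h1 : sphPre D.d m r A < sphPre D.d m r A + ε / 2 := ENNReal.lt_add_right htop hε2
  conv_lhs at h1 => rw [sphPre, OuterMeasure.boundedBy_apply]
  simp only [iInf_lt_iff] at h1
  obtain ⟨t, ht, hsum⟩ := h1
  obtain ⟨ε', hε', hε'sum⟩ := ENNReal.exists_pos_sum_of_countable hε2 ℕ
  have hB : ∀ j, ∃ B : Set (Hpt n), IsOpen B ∧ t j ⊆ B ∧ 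
      sphPre D.d m r B ≤ (⨆ (_ : (t j).Nonempty), sphGauge D.d m r (t j)) + ε' j := by
    intro j
    rcases (t j).eq_empty_or_nonempty with h | h
    · exact ⟨∅, isOpen_empty, by simp [h], by simp⟩
    simp only [h, iSup_pos]
    by_cases hg : sphGauge D.d m r (t j) = ⊤
    · exact ⟨univ, isOpen_univ, subset_univ _, by simp [hg]⟩
    have h2 : sphGauge D.d m r (t j) < sphGauge D.d m r (t j) + ε' j := 
      ENNReal.lt_add_right hg (by simpa using (hε' j).ne')
    conv_lhs at h2 => rw [sphGauge]
    simp only [iInf_lt_iff] at h2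
    obtain ⟨c, ρ, h0, hr, hs, hlt⟩ := h2
    exact ⟨_, D.isOpen_ball c ρ, hs, (sphPre_ball_le h0 hr Subset.rfl).trans hlt.le⟩
  choose B hBo hBt hBs using hB
  refine ⟨⋃ j, B j, isOpen_iUnion hBo, ht.trans (iUnion_mono hBt), ?_⟩
  calc sphPre D.d m r (⋃ j, B j) ≤ ∑' j, sphPre D.d m r (B j) := measure_iUnion_le _
    _ ≤ ∑' j, ((⨆ (_ : (t j).Nonempty), sphGauge D.d m r (t j)) + ε' j) := ENNReal.tsum_le_tsum hBs
    _ = _ := ENNReal.tsum_add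
    _ ≤ (sphPre D.d m r A + ε / 2) + ε / 2 := add_le_add hsum.le hε'sum.le
    _ = _ := by rw [add_assoc, ENNReal.add_halves]

/-- rescaling map -/
def blow (p : Hpt n) (ρ : ℝ) (q : Hpt n) : Hpt n := hdil ρ⁻¹ (hmul (hinv p) q)

lemma blow_d (D : HomDist n) (p : Hpt n) {ρ : ℝ} (hρ : 0 < ρ) (q q' : Hpt n) :
    D.d (blow p ρ q) (blow p ρ q') = ρ⁻¹ * D.d q q' := by
  rw [blow, blow, D.homog _ (inv_pos.2 hρ), D.leftInv]

lemma blow_surj (p : Hpt n) {ρ : ℝ} (hρ : 0 < ρ) (q : Hpt n) : ∃ q', blow p ρ q' = q := by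
  refine ⟨hmul p (hdil ρ q), ?_⟩
  rw [blow, hinv_hmul_cancel, hdil_hdil, inv_mul_cancel₀ hρ.ne', hdil_one]

lemma blow_inj (D : HomDist n) (p : Hpt n) {ρ : ℝ} (hρ : 0 < ρ) : Function.Injective (blow p ρ) := by
  intro q q' h
  rw [← D.eq_iff]
  have := blow_d D p hρ q q'
  rw [h, D.d_self] at this
  have h2 := (inv_pos.2 hρ).ne'
  exact (mul_eq_zero.1 this.symm).resolve_left h2

lemma sphPre_blow (D : HomDist n) (m r : ℝ) (p : Hpt n) {ρ : ℝ} (hρ : 0 < ρ) (B : Set (Hpt n)) :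
    sphPre D.d m (ρ * r) B ≤ ENNReal.ofReal (ρ ^ m) * sphPre D.d m r (blow p ρ '' B) := by
  have h : OuterMeasure.map (blow p ρ) (sphPre D.d m (ρ * r)) ≤ 
      ENNReal.ofReal (ρ ^ m) • sphPre D.d m r := by
    rw [sphPre, sphPre, OuterMeasure.smul_boundedBy ENNReal.ofReal_ne_top, OuterMeasure.le_boundedBy]
    intro s
    rw [OuterMeasure.map_apply]
    simp only [Pi.smul_apply, smul_eq_mul]
    have hpos : 0 < ρ ^ m := Real.rpow_pos_of_pos hρ m
    rw [mul_comm (ENNReal.ofReal (ρ ^ m)), ← ENNReal.div_le_iff_le_mul (Or.inl (by simpa using hpos)) (Or.inl ENNReal.ofReal_ne_top)]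
    refine le_iInf fun c => le_iInf fun ρ' => le_iInf fun h0 => le_iInf fun h1 => le_iInf fun hs => ?_
    rw [ENNReal.div_le_iff_le_mul (Or.inl (by simpa using hpos)) (Or.inl ENNReal.ofReal_ne_top)]
    obtain ⟨c', rfl⟩ := blow_surj p hρ c
    have : blow p ρ ⁻¹' s ⊆ rawBall D.d c' (ρ * ρ') := by
      intro q hq
      have := hs hq
      simp only [rawBall, mem_ofPred_eq] at this ⊢
      rw [blow_d D p hρ, inv_mul_lt_iff₀ hρ] at this
      exact this
    refine (sphPre_ball_le (by positivity) (by gcongr) this).trans ?_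
    rw [← ENNReal.ofReal_mul (by positivity), ← Real.mul_rpow (by positivity) hρ.le]
    rw [show 2 * (ρ * ρ') = 2 * ρ' * ρ by ring]
  have h2 := h (blow p ρ '' B)
  rw [OuterMeasure.map_apply, preimage_image_eq _ (blow_inj D p hρ)] at h2
  exact h2

/-! Vitali covering -/

/-- The Heisenberg group with a homogeneous distance as a metric space. -/
def MS (_ : HomDist n) : Type := Hpt n

instance (D : HomDist n) : MeasurableSpace (MS D) := inferInstanceAs (MeasurableSpace (Hpt n))

/-- The topology of the homogeneous distance is the Euclidean one. -/
@[reducible]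
def psm0 (D : HomDist n) : PseudoMetricSpace (Hpt n) where
  dist := D.d
  dist_self := D.d_self
  dist_comm := D.symm
  dist_triangle := D.triangle

lemma psm_top [NeZero n] (D : HomDist n) : 
    (inferInstance : TopologicalSpace (Hpt n)) = (psm0 D).toUniformSpace.toTopologicalSpace := by
  apply TopologicalSpace.ext_nhds
  intro p
  refine (D.hasBasis_nhds p).eq_of_same_basis ?_
  have := @Metric.nhds_basis_ball _ (psm0 D) p
  convert this using 2 with ε
  ext q
  exact ⟨fun h => (D.symm q p).trans_lt h, fun h => (D.symm p q).trans_lt h⟩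

instance [NeZero n] (D : HomDist n) : PseudoMetricSpace (MS D) := 
  (psm0 D).replaceTopology (psm_top D)

instance [NeZero n] (D : HomDist n) : BorelSpace (MS D) := inferInstanceAs (BorelSpace (Hpt n))
instance [NeZero n] (D : HomDist n) : SecondCountableTopology (MS D) := 
  inferInstanceAs (SecondCountableTopology (Hpt n))

lemma MS_dist [NeZero n] (D : HomDist n) (p q : MS D) : dist p q = D.d p q := rfl

/-- Closed ball. -/
def cB (D : HomDist n) (p : Hpt n) (r : ℝ) : Set (Hpt n) := {q | D.d p q ≤ r}

lemma MS_cball [NeZero n] (D : HomDist n) (p : MS D) (r : ℝ) : 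
    Metric.closedBall p r = cB D p r := by
  ext q; exact ⟨fun h => (D.symm p q).trans_le h, fun h => (D.symm q p).trans_le h⟩

section
variable [NeZero n] (D : HomDist n) {k : ℕ} (ι : E0 n k →ₗᵢ[ℝ] ZS n)

lemma Hm_cB (p : Hpt n) {r : ℝ} (hr : 0 < r) : Hm ι (cB D p r) = 
    ENNReal.ofReal (r ^ (Module.finrank ℝ (E0 n k) + 2)) * 
      Psi (E0 n k) D (r⁻¹ * aperp ι (zz p)) (Iic 1) := by
  have := Hm_eq_Psi D ι p (measurableSet_Iic (a := r))
  rw [← Psi_scale_Iic D hr, mul_inv_cancel_left₀ hr.ne', mul_one, ← this]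
  rfl

lemma aperp_range (x : E0 n k × ℝ) : aperp ι (zz (vpar ι x)) = 0 := by
  have : iadj ι (ι x.1) = x.1 := by
    refine ext_inner_left ℝ fun v => ?_
    rw [inner_iadj, LinearIsometry.inner_map_map]
  rw [vpar, zz_mkH, aperp, this, sub_self, norm_zero]

lemma aperp_smul {l : ℝ} (hl : 0 ≤ l) (z : ZS n) : aperp ι (l • z) = l * aperp ι z := by
  rw [aperp, map_smul, map_smul, ← smul_sub, norm_smul, Real.norm_of_nonneg hl, aperp]

lemma aperp_add_range (v : E0 n k) (z : ZS n) : aperp ι (ι v + z) = aperp ι z := by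
  have : iadj ι (ι v) = v := by
    refine ext_inner_left ℝ fun w => ?_
    rw [inner_iadj, LinearIsometry.inner_map_map]
  rw [aperp, map_add, map_add, this, aperp]; congr 1; abel

lemma countable_of_disj {I : Type*} {u : Set I} {B : I → Set (Hpt n)} (hd : u.PairwiseDisjoint B)
    (hinter : ∀ a ∈ u, (interior (B a)).Nonempty) : u.Countable :=
  hd.countable_of_nonempty_interior hinter

lemma cB_interior (p : Hpt n) {r : ℝ} (hr : 0 < r) : (interior (cB D p r)).Nonempty := by
  refine ⟨p, mem_interior.2 ⟨rawBall D.d p r, fun q hq => ?_, D.isOpen_ball p r, ?_⟩⟩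
  · have h : D.d p q < r := hq
    exact h.le
  · simp [rawBall, D.d_self, hr]

lemma exists_cB_subset {G : Set (Hpt n)} (hG : IsOpen G) {x : Hpt n} (hx : x ∈ G) :
    ∃ ε > 0, cB D x ε ⊆ G := by
  obtain ⟨ε, hε, h⟩ := (D.hasBasis_nhds x).mem_iff.1 (hG.mem_nhds hx)
  refine ⟨ε / 2, by positivity, fun q hq => h ?_⟩
  have h2 : D.d x q ≤ ε / 2 := hq
  change D.d x q < ε
  linarith

lemma sum_Hm_le {u : Set (Hpt n × ℝ)} (hu : u.Countable) {B : Hpt n × ℝ → Set (Hpt n)} 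
    (hd : u.PairwiseDisjoint B) (hc : ∀ a ∈ u, IsClosed (B a)) {G : Set (Hpt n)} 
    (hG : ∀ a ∈ u, B a ⊆ G) : ∑' a : u, Hm ι (B a) ≤ Hm ι G := by
  rw [← measure_biUnion hu hd fun a ha => (hc a ha).measurableSet]
  exact measure_mono (iUnion₂_subset hG)

/-- exponent -/
def mexp (n k : ℕ) : ℕ := Module.finrank ℝ (E0 n k) + 2

lemma null_pre {δ : ℝ} (hδ : 0 < δ) {N : Set (Hpt n)} (hN : N ⊆ range (vpar ι)) (h0 : Hm ι N = 0) :
    sphPre D.d (mexp n k : ℝ) δ N = 0 := by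
  haveI : Nonempty (HomDist n) := ⟨D⟩
  set b := Psi (E0 n k) D 0 (Iic 1) with hb
  have hb0 : b ≠ 0 := ((Psi_zero_pos D).trans_le (Psi_mono D _ Iio_subset_Iic_self)).ne'
  have hbt : b ≠ ⊤ := (Psi_lt_top D 0).ne
  have hball : ∀ w ∈ N, ∀ ρ : ℝ, 0 < ρ → Hm ι (cB D w ρ) = ENNReal.ofReal (ρ ^ (mexp n k)) * b := by
    intro w hw ρ hρ
    obtain ⟨x, rfl⟩ := hN hw
    rw [Hm_cB D ι _ hρ, aperp_range, mul_zero]; rfl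
  set Cc : ℝ≥0∞ := ENNReal.ofReal (12 ^ (mexp n k)) / b with hCc
  have hCt : Cc ≠ ⊤ := ENNReal.div_ne_top ENNReal.ofReal_ne_top hb0
  have key : ∀ ε : ℝ≥0∞, ε ≠ 0 → sphPre D.d (mexp n k : ℝ) δ N ≤ Cc * ε := by
    intro ε hε
    obtain ⟨G, hNG, hGo, hGε⟩ := Set.exists_isOpen_lt_of_lt (μ := Hm ι) N ε 
      (by rw [h0]; exact pos_iff_ne_zero.2 hε)
    let t : Set (Hpt n × ℝ) := {a | a.1 ∈ N ∧ 0 < a.2 ∧ 6 * a.2 < δ ∧ cB D a.1 a.2 ⊆ G}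
    obtain ⟨u, hut, hdis, hcov⟩ := Vitali.exists_disjoint_subfamily_covering_enlargement_closedBall
      (α := MS D) t (fun a => a.1) (fun a => a.2) δ (fun a ha => by
        have h1 := ha.2.1; have h2 := ha.2.2.1; linarith) 5 (by norm_num)
    have hdis' : u.PairwiseDisjoint fun a => cB D a.1 a.2 := by
      intro a ha b hb hab
      have := hdis ha hb hab
      exact Set.disjoint_left.2 fun q h1 h2 => Set.disjoint_left.1 this
        ((MS_cball D a.1 a.2).symm.subset h1) ((MS_cball D b.1 b.2).symm.subset h2)
    have huc : u.Countable := countable_of_disj hdis' fun a ha => cB_interior D _ (hut ha).2.1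
    haveI := huc.to_subtype
    have hsub : N ⊆ ⋃ a : u, cB D a.1.1 (5 * a.1.2) := by
      intro x hx
      obtain ⟨ε', hε', hG'⟩ := exists_cB_subset D hGo (hNG hx)
      have hpos : 0 < min ε' (δ / 7) := by positivity
      have hxt : (x, min ε' (δ / 7)) ∈ t := by
        refine ⟨hx, hpos, ?_, fun q hq => hG' ?_⟩
        swap
        · have hq' : D.d x q ≤ min ε' (δ / 7) := hq
          exact le_trans hq' (min_le_left _ _)
        have : min ε' (δ / 7) ≤ δ / 7 := min_le_right _ _
        simp only
        linarith
      obtain ⟨b, hb, hsub⟩ := hcov _ hxt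
      refine mem_iUnion.2 ⟨⟨b, hb⟩, (MS_cball D b.1 _).subset (hsub ((MS_cball D x _).symm.subset ?_))⟩
      change D.d x x ≤ min ε' (δ / 7)
      rw [D.d_self]; exact hpos.le
    calc sphPre D.d (mexp n k : ℝ) δ N ≤ sphPre D.d (mexp n k : ℝ) δ (⋃ a : u, cB D a.1.1 (5 * a.1.2)) := 
          measure_mono hsub
      _ ≤ ∑' a : u, sphPre D.d (mexp n k : ℝ) δ (cB D a.1.1 (5 * a.1.2)) := measure_iUnion_le _
      _ ≤ ∑' a : u, Cc * Hm ι (cB D a.1.1 a.1.2) := by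
          refine ENNReal.tsum_le_tsum fun a => ?_
          obtain ⟨h1, h2, h3, h4⟩ := hut a.2
          rw [hball _ h1 _ h2]
          have : cB D a.1.1 (5 * a.1.2) ⊆ rawBall D.d a.1.1 (6 * a.1.2) := by
            intro q hq
            have hq' : D.d a.1.1 q ≤ 5 * a.1.2 := hq
            change D.d a.1.1 q < 6 * a.1.2
            linarith
          refine (sphPre_ball_le (by linarith) h3 this).trans ?_
          have e1 : Cc * (ENNReal.ofReal (a.1.2 ^ (mexp n k)) * b) =
              ENNReal.ofReal ((12 * a.1.2) ^ (mexp n k)) := by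
            rw [mul_comm (ENNReal.ofReal (a.1.2 ^ _)), ← mul_assoc Cc, hCc, ENNReal.div_mul_cancel hb0 hbt,
              ← ENNReal.ofReal_mul (by positivity), ← mul_pow]
          rw [e1, Real.rpow_natCast, show 2 * (6 * a.1.2) = 12 * a.1.2 by ring]
      _ = Cc * ∑' a : u, Hm ι (cB D a.1.1 a.1.2) := ENNReal.tsum_mul_left
      _ ≤ Cc * Hm ι G := by
          gcongr
          exact sum_Hm_le ι huc hdis' (fun a _ => D.isClosed_cball _ _) fun a ha => (hut ha).2.2.2
      _ ≤ Cc * ε := by gcongr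
  have hlim : Tendsto (fun ε : ℝ≥0∞ => Cc * ε) (𝓝[>] 0) (𝓝 0) := by
    have := (ENNReal.Tendsto.const_mul (a := Cc) (tendsto_id (x := 𝓝 (0:ℝ≥0∞))) (Or.inr hCt))
    rw [mul_zero] at this
    exact this.mono_left nhdsWithin_le_nhds
  refine le_antisymm (ge_of_tendsto hlim ?_) zero_le
  filter_upwards [self_mem_nhdsWithin] with ε hε
  exact key ε (ne_of_gt hε)

end

end Part3

section Part4
set_option linter.unusedSectionVars false

/-! ## Proof, part 4: the flat case -/

section
variable [NeZero n] (D : HomDist n) {k : ℕ} (ι : E0 n k →ₗᵢ[ℝ] ZS n)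

lemma vitali_cB [Nonempty (HomDist n)] (s : Set (Hpt n)) (t : Set (Hpt n × ℝ)) (C : NNReal) 
    (r : Hpt n × ℝ → ℝ) (B : Hpt n × ℝ → Set (Hpt n)) 
    (hB : ∀ a ∈ t, B a ⊆ cB D a.1 (r a))
    (μB : ∀ a ∈ t, Hm ι (cB D a.1 (3 * r a)) ≤ C * Hm ι (B a))
    (ht : ∀ a ∈ t, (interior (B a)).Nonempty) (h't : ∀ a ∈ t, IsClosed (B a))
    (hf : ∀ x ∈ s, ∀ ε > (0 : ℝ), ∃ a ∈ t, r a ≤ ε ∧ a.1 = x) :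
    ∃ u ⊆ t, u.Countable ∧ u.PairwiseDisjoint B ∧ Hm ι (s \ ⋃ a ∈ u, B a) = 0 := by
  have inst : IsLocallyFiniteMeasure (Hm ι) := inferInstance
  let μ : Measure (MS D) := Hm ι
  have inst2 : IsLocallyFiniteMeasure μ := inst
  refine Vitali.exists_disjoint_covering_ae (α := MS D) μ s t C r (fun a => a.1) B ?_ ?_ ht h't hf
  · intro a ha
    exact (hB a ha).trans (MS_cball D a.1 (r a)).symm.subset
  · intro a ha
    exact (measure_mono (MS_cball D a.1 (3 * r a)).subset).trans (μB a ha)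

lemma flat_step (hk1 : 1 ≤ k) (hk : k ≤ n) {a : ℝ} (ha : 0 ≤ a) 
    (hb0 : Psi (E0 n k) D a (Iic 1) ≠ 0) {lam : ℝ} (hlam : 1 < lam) {δ : ℝ} (hδ : 0 < δ) 
    {N : Set (Hpt n)} (hN : N ⊆ range (vpar ι)) (hfin : Hm ι N ≠ ⊤) :
    sphPre D.d (mexp n k : ℝ) δ N ≤ 
      ENNReal.ofReal ((2 * lam) ^ mexp n k) / Psi (E0 n k) D a (Iic 1) * Hm ι N := by
  have : Nonempty (HomDist n) := ⟨D⟩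
  set b := Psi (E0 n k) D a (Iic 1) with hb
  have hbt : b ≠ ⊤ := (Psi_lt_top D a).ne
  obtain ⟨z, hz, hzn⟩ := exists_perp hk1 hk ι ha
  set ps : Hpt n := mkH z 0 with hps
  set l := D.nm ps with hl
  have hl0 : 0 ≤ l := D.nm_nonneg _
  let cen : Hpt n × ℝ → Hpt n := fun a => hmul a.1 (hdil a.2 ps)
  let B : Hpt n × ℝ → Set (Hpt n) := fun a => cB D (cen a) a.2
  have hcen : ∀ a : Hpt n × ℝ, 0 < a.2 → D.d a.1 (cen a) = a.2 * l := by
    intro a ha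
    rw [D.d_eq, hinv_hmul_cancel, D.nm_hdil ha]
  have hBm : ∀ a : Hpt n × ℝ, a.1 ∈ N → 0 < a.2 → 
      Hm ι (B a) = ENNReal.ofReal (a.2 ^ mexp n k) * b := by
    rintro ⟨w, ρ⟩ hw hρ
    obtain ⟨x, rfl⟩ := hN hw
    simp only at hρ
    have : aperp ι (zz (cen (vpar ι x, ρ))) = ρ * a := by
      simp only [cen, vpar, hps, hdil_mkH, hmul_mkH, zz_mkH]
      rw [aperp_add_range, aperp_smul ι hρ.le, hz]
    simp only [B]
    rw [Hm_cB D ι _ hρ, this, inv_mul_cancel_left₀ hρ.ne']; rfl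
  have hcB : ∀ w ∈ N, ∀ ρ : ℝ, 0 < ρ → Hm ι (cB D w ρ) = 
      ENNReal.ofReal (ρ ^ (mexp n k)) * Psi (E0 n k) D 0 (Iic 1) := by
    intro w hw ρ hρ
    obtain ⟨x, rfl⟩ := hN hw
    rw [Hm_cB D ι _ hρ, aperp_range, mul_zero]; rfl
  have hBsub : ∀ a : Hpt n × ℝ, 0 < a.2 → B a ⊆ cB D a.1 ((l + 1) * a.2) := by
    intro a ha q hq
    have h1 : D.d (cen a) q ≤ a.2 := hq
    have h2 := D.triangle a.1 (cen a) q
    rw [hcen a ha] at h2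
    change D.d a.1 q ≤ _
    linarith
  set Cc : ℝ≥0∞ := ENNReal.ofReal ((2 * lam) ^ (mexp n k)) / b with hCc
  have hCt : Cc ≠ ⊤ := ENNReal.div_ne_top ENNReal.ofReal_ne_top hb0
  set K : ℝ≥0∞ := ENNReal.ofReal ((3 * (l + 1)) ^ (mexp n k)) * Psi (E0 n k) D 0 (Iic 1) / b with hK
  have hKt : K ≠ ⊤ := ENNReal.div_ne_top 
    (ENNReal.mul_ne_top ENNReal.ofReal_ne_top (Psi_lt_top D 0).ne) hb0
  have key : ∀ ε : ℝ≥0∞, ε ≠ 0 → sphPre D.d (mexp n k : ℝ) δ N ≤ Cc * (Hm ι N + ε) := by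
    intro ε hε
    obtain ⟨G, hNG, hGo, hGε⟩ := Set.exists_isOpen_lt_of_lt (μ := Hm ι) N (Hm ι N + ε) 
      (ENNReal.lt_add_right hfin hε)
    let t : Set (Hpt n × ℝ) := {a | a.1 ∈ N ∧ 0 < a.2 ∧ lam * a.2 < δ ∧ B a ⊆ G}
    obtain ⟨u, hut, huc, hdis, hcov⟩ := vitali_cB D ι N t K.toNNReal (fun a => (l + 1) * a.2) B
      (fun a ha => hBsub a ha.2.1) 
      (by
        rintro a ⟨h1, h2, -, -⟩
        rw [hBm a h1 h2, hcB _ h1 _ (by positivity), ENNReal.coe_toNNReal hKt,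
          mul_comm (ENNReal.ofReal (a.2 ^ _)), ← mul_assoc K, hK, ENNReal.div_mul_cancel hb0 hbt,
          mul_right_comm, ← ENNReal.ofReal_mul (by positivity), ← mul_pow, mul_assoc 3])
      (fun a ha => cB_interior D _ ha.2.1) (fun a _ => D.isClosed_cball _ _)
      (by
        intro x hx ε' hε'
        obtain ⟨e, he, hG'⟩ := exists_cB_subset D hGo (hNG hx)
        have hl1 : 0 < l + 1 := by linarith
        set ρ := min (min (e / (l + 1)) (δ / (2 * lam))) (ε' / (l + 1)) with hρ
        have hlam0 : 0 < lam := by linarith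
        have hρ0 : 0 < ρ := by positivity
        have h1 : ρ ≤ e / (l + 1) := (min_le_left _ _).trans (min_le_left _ _)
        have h2 : ρ ≤ δ / (2 * lam) := (min_le_left _ _).trans (min_le_right _ _)
        have h3 : ρ ≤ ε' / (l + 1) := min_le_right _ _
        rw [le_div_iff₀ (by positivity)] at h1 h2 h3
        refine ⟨(x, ρ), ⟨hx, hρ0, ?_, ?_⟩, ?_, rfl⟩
        · simp only; linarith
        · refine (hBsub (x, ρ) hρ0).trans (Subset.trans ?_ hG')
          intro q hq
          have hq' : D.d x q ≤ (l + 1) * ρ := hq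
          change D.d x q ≤ e
          linarith
        · simp only; linarith)
    have : Countable u := huc.to_subtype
    have hsub : N ⊆ (⋃ a : u, B a) ∪ (N \ ⋃ a ∈ u, B a) := by
      intro x hx
      by_cases h : x ∈ ⋃ a ∈ u, B a
      · left; rwa [biUnion_eq_iUnion] at h
      · right; exact ⟨hx, h⟩
    calc sphPre D.d (mexp n k : ℝ) δ N 
        ≤ sphPre D.d (mexp n k : ℝ) δ ((⋃ a : u, B a) ∪ (N \ ⋃ a ∈ u, B a)) := measure_mono hsub
      _ ≤ sphPre D.d (mexp n k : ℝ) δ (⋃ a : u, B a) + sphPre D.d (mexp n k : ℝ) δ (N \ ⋃ a ∈ u, B a) := 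
          measure_union_le _ _
      _ = sphPre D.d (mexp n k : ℝ) δ (⋃ a : u, B a) := by
          rw [null_pre D ι hδ (diff_subset.trans hN) hcov, add_zero]
      _ ≤ ∑' a : u, sphPre D.d (mexp n k : ℝ) δ (B a) := measure_iUnion_le _
      _ ≤ ∑' a : u, Cc * Hm ι (B a) := by
          refine ENNReal.tsum_le_tsum fun a => ?_
          obtain ⟨h1, h2, h3, h4⟩ := hut a.2
          rw [hBm _ h1 h2]
          have : B a ⊆ rawBall D.d (cen a) (lam * a.1.2) := by
            intro q hq
            have hq' : D.d (cen a) q ≤ a.1.2 := hq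
            change D.d (cen a) q < lam * a.1.2
            nlinarith
          refine (sphPre_ball_le (by nlinarith) h3 this).trans ?_
          have e1 : Cc * (ENNReal.ofReal (a.1.2 ^ (mexp n k)) * b) =
              ENNReal.ofReal ((2 * lam * a.1.2) ^ (mexp n k)) := by
            rw [mul_comm (ENNReal.ofReal (a.1.2 ^ _)), ← mul_assoc Cc, hCc, ENNReal.div_mul_cancel hb0 hbt,
              ← ENNReal.ofReal_mul (by positivity), ← mul_pow]
          rw [e1, Real.rpow_natCast, mul_assoc]
      _ = Cc * ∑' a : u, Hm ι (B a) := ENNReal.tsum_mul_left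
      _ ≤ Cc * Hm ι G := by
          gcongr
          exact sum_Hm_le ι huc hdis (fun a _ => D.isClosed_cball _ _) fun a ha => (hut ha).2.2.2
      _ ≤ Cc * (Hm ι N + ε) := by gcongr
  have hlim : Tendsto (fun ε : ℝ≥0∞ => Cc * (Hm ι N + ε)) (𝓝[>] 0) (𝓝 (Cc * Hm ι N)) := by
    have h1 : Tendsto (fun ε : ℝ≥0∞ => Hm ι N + ε) (𝓝 0) (𝓝 (Hm ι N + 0)) := 
      tendsto_const_nhds.add tendsto_id
    have := (ENNReal.Tendsto.const_mul (a := Cc) h1 (Or.inr hCt))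
    rw [add_zero] at this
    exact this.mono_left nhdsWithin_le_nhds
  refine ge_of_tendsto hlim ?_
  filter_upwards [self_mem_nhdsWithin] with ε hε
  exact key ε (ne_of_gt hε)

lemma flat_bound (hk1 : 1 ≤ k) (hk : k ≤ n) {δ : ℝ} (hδ : 0 < δ) 
    {N : Set (Hpt n)} (hN : N ⊆ range (vpar ι)) (hfin : Hm ι N ≠ ⊤) :
    sphPre D.d (mexp n k : ℝ) δ N ≤ ENNReal.ofReal (2 ^ mexp n k / beta D k) * Hm ι N := by
  have hβ := beta_pos D hk1 hk
  have key : ∀ lam : ℝ, 1 < lam → sphPre D.d (mexp n k : ℝ) δ N ≤ 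
      ENNReal.ofReal ((2 * lam) ^ mexp n k / (beta D k / lam)) * Hm ι N := by
    intro lam hlam
    have hb : beta D k / lam < beta D k := div_lt_self hβ hlam
    obtain ⟨a, ha, hle⟩ := exists_lt_beta D hb
    have hpos : 0 < beta D k / lam := by positivity
    have h0 : 0 < ENNReal.ofReal (beta D k / lam) := ENNReal.ofReal_pos.2 hpos
    refine (flat_step D ι hk1 hk ha (h0.trans_le hle).ne' hlam hδ hN hfin).trans ?_
    gcongr
    rw [ENNReal.ofReal_div_of_pos hpos]
    gcongr
  have hlim : Tendsto (fun lam : ℝ => ENNReal.ofReal ((2 * lam) ^ mexp n k / (beta D k / lam)) * Hm ι N) 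
      (𝓝[>] 1) (𝓝 (ENNReal.ofReal (2 ^ mexp n k / beta D k) * Hm ι N)) := by
    refine ENNReal.Tendsto.mul_const ?_ (Or.inr hfin)
    refine ENNReal.tendsto_ofReal ?_
    have hc : ContinuousAt (fun lam : ℝ => (2 * lam) ^ mexp n k / (beta D k / lam)) 1 := by
      refine ContinuousAt.div (by fun_prop) (ContinuousAt.div (by fun_prop) (by fun_prop) (by simp)) ?_
      simpa using hβ.ne'
    have := hc.tendsto
    simp only [mul_one, div_one] at this
    exact this.mono_left nhdsWithin_le_nhds
  refine ge_of_tendsto hlim ?_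
  filter_upwards [self_mem_nhdsWithin] with ε hε
  exact key ε hε

/-- closed unit balls of the second distance -/
lemma flat_ball (D2 : HomDist n) (hk1 : 1 ≤ k) (hk : k ≤ n) {δ : ℝ} (hδ : 0 < δ) (c : Hpt n) :
    sphPre D.d (mexp n k : ℝ) δ (range (vpar ι) ∩ cB D2 c 1) ≤ 
      ENNReal.ofReal (2 ^ mexp n k * beta D2 k / beta D k) := by
  have hβ := beta_pos D hk1 hk
  have h1 : Hm ι (range (vpar ι) ∩ cB D2 c 1) ≤ ENNReal.ofReal (beta D2 k) := by
    refine (measure_mono inter_subset_right).trans ?_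
    rw [Hm_cB D2 ι c one_pos]
    simp only [one_pow, ENNReal.ofReal_one, one_mul]
    exact Psi_Iic_le_beta D2 hk1 hk (by simp only [aperp]; positivity)
  refine (flat_bound D ι hk1 hk hδ inter_subset_left (h1.trans_lt ENNReal.ofReal_lt_top).ne).trans ?_
  rw [mul_div_right_comm, ENNReal.ofReal_mul (by positivity)]
  gcongr

end

end Part4

section Part5
set_option linter.unusedSectionVars false

/-! ## Proof, part 5: Pansu differentiability -/

open HomDist

/-- Horizontal index. -/
def kap : Fin n ⊕ Fin n → Fin (2 * n)
  | Sum.inl j => ⟨j, by omega⟩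
  | Sum.inr j => ⟨n + j, by omega⟩

/-- Horizontal gradient as an element of the Euclidean space. -/
def gv (f : Hpt n → ℝ) (p : Hpt n) : ZS n := WithLp.toLp 2 fun i => gradH f p (kap i)

/-- Elementary horizontal move. -/
def mv (x : (Fin n ⊕ Fin n) × ℝ) : Hpt n := mkH (x.2 • eZ x.1) 0

/-- Product of elementary moves. -/
def pr : List ((Fin n ⊕ Fin n) × ℝ) → Hpt n
  | [] => 0
  | x :: L => hmul (mv x) (pr L)

/-- Length. -/
def len : List ((Fin n ⊕ Fin n) × ℝ) → ℝ
  | [] => 0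
  | x :: L => |x.2| + len L

lemma frameVec_inl (j : Fin n) (p : Hpt n) : 
    frameVec (hIdx (kap (Sum.inl j))) p = (Pi.single j 1, 0, -(p.2.1 j) / 2) := by
  simp [frameVec, hIdx, kap]

lemma frameVec_inr (j : Fin n) (p : Hpt n) : 
    frameVec (hIdx (kap (Sum.inr j))) p = (0, Pi.single j 1, p.1 j / 2) := by
  have : n + (j : ℕ) < 2 * n := by omega
  simp [frameVec, hIdx, kap, this]

lemma hmul_mv (p : Hpt n) (i : Fin n ⊕ Fin n) (s : ℝ) : 
    hmul p (mv (i, s)) = p + s • frameVec (hIdx (kap i)) p := by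
  obtain ⟨x, y, t⟩ := p
  rcases i with j | j
  · rw [frameVec_inl]
    simp only [hmul, mv, mkH, eZ]
    refine Prod.ext ?_ (Prod.ext ?_ ?_)
    · ext l; simp [Pi.single_apply]
    · ext l; simp
    · simp [Pi.single_apply]; ring
  · rw [frameVec_inr]
    simp only [hmul, mv, mkH, eZ]
    refine Prod.ext ?_ (Prod.ext ?_ ?_)
    · ext l; simp
    · ext l; simp [Pi.single_apply]
    · simp [Pi.single_apply]; ring

lemma frameVec_line (p : Hpt n) (i : Fin n ⊕ Fin n) (s : ℝ) : 
    frameVec (hIdx (kap i)) (p + s • frameVec (hIdx (kap i)) p) = frameVec (hIdx (kap i)) p := by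
  rcases i with j | j
  · simp [frameVec_inl]
  · simp [frameVec_inr]

lemma hasDerivAt_line {U : Set (Hpt n)} {f : Hpt n → ℝ} (hf : IsC1H U f) (p : Hpt n) (i : Fin n ⊕ Fin n) 
    (s : ℝ) (hs : hmul p (mv (i, s)) ∈ U) : 
    HasDerivAt (fun s => f (hmul p (mv (i, s)))) (gradH f (hmul p (mv (i, s))) (kap i)) s := by
  have h := (hf.ldiff _ hs (kap i)).hasLineDerivAt
  rw [HasLineDerivAt] at h
  have h2 : HasDerivAt (fun t => f (hmul p (mv (i, s)) + t • frameVec (hIdx (kap i)) (hmul p (mv (i, s)))))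
    (gradH f (hmul p (mv (i, s))) (kap i)) (s - s) := by rw [sub_self]; exact h
  have h3 := h2.comp_sub_const s s
  refine h3.congr_of_eventuallyEq (Eventually.of_forall fun t => ?_)
  simp only [hmul_mv, frameVec_line]
  congr 1
  rw [add_assoc, ← add_smul]; congr 2; ring

lemma zz_hmul (p q : Hpt n) : zz (hmul p q) = zz p + zz q := by
  obtain ⟨z, t, rfl⟩ := mkH_eta p
  obtain ⟨w, s, rfl⟩ := mkH_eta q
  rw [hmul_mkH, zz_mkH, zz_mkH, zz_mkH]

lemma zz_hinv (p : Hpt n) : zz (hinv p) = - zz p := by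
  obtain ⟨z, t, rfl⟩ := mkH_eta p
  rw [hinv_mkH, zz_mkH, zz_mkH]

lemma zz_hdil (l : ℝ) (p : Hpt n) : zz (hdil l p) = l • zz p := by
  obtain ⟨z, t, rfl⟩ := mkH_eta p
  rw [hdil_mkH, zz_mkH, zz_mkH]

lemma pr_append (L M : List ((Fin n ⊕ Fin n) × ℝ)) : pr (L ++ M) = hmul (pr L) (pr M) := by
  induction L with
  | nil => simp [pr, zero_hmul]
  | cons x L ih => simp only [List.cons_append, pr, ih, hmul_assoc]

lemma len_append (L M : List ((Fin n ⊕ Fin n) × ℝ)) : len (L ++ M) = len L + len M := by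
  induction L with
  | nil => simp [len]
  | cons x L ih => simp only [List.cons_append, len, ih, add_assoc]

lemma len_nonneg (L : List ((Fin n ⊕ Fin n) × ℝ)) : 0 ≤ len L := by
  induction L with
  | nil => simp [len]
  | cons x L ih => simp only [len]; positivity

lemma zz_pr_map (l : List (Fin n ⊕ Fin n)) (z : ZS n) : 
    zz (pr (l.map fun i => (i, z i))) = (l.map fun i => z i • eZ i).sum := by
  induction l with
  | nil => simp [pr, ← mkH_zero, zz_mkH]
  | cons x L ih => simp only [List.map_cons, pr, zz_hmul, ih, mv, zz_mkH, List.sum_cons]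

lemma len_map_le (l : List (Fin n ⊕ Fin n)) (z : ZS n) : 
    len (l.map fun i => (i, z i)) ≤ l.length * ‖z‖ := by
  induction l with
  | nil => simp [len]
  | cons x L ih => 
    simp only [List.map_cons, len, List.length_cons]
    have : |z x| ≤ ‖z‖ := PiLp.norm_apply_le z x
    push_cast
    linarith

lemma sum_eZ (z : ZS n) : ((Finset.univ : Finset (Fin n ⊕ Fin n)).toList.map fun i => z i • eZ i).sum = z := by
  rw [Finset.sum_map_toList]
  ext j
  rcases j with j | j <;> simp [eZ, Pi.single_apply]

lemma om_eZ [NeZero n] : om (eZ (Sum.inl 0) : ZS n) (eZ (Sum.inr 0)) = 1 / 2 := by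
  simp [om, eZ, Pi.single_apply]

lemma om_eZ' [NeZero n] : om (eZ (Sum.inr 0) : ZS n) (eZ (Sum.inl 0)) = - (1 / 2) := by
  simp [om, eZ]

lemma pr_comm [NeZero n] (a b : ℝ) : 
    pr [(Sum.inl (0 : Fin n), a), (Sum.inr 0, b), (Sum.inl 0, -a), (Sum.inr 0, -b)] = mkH 0 (a * b) := by
  simp only [pr, mv, ← mkH_zero, hmul_mkH]
  congr 1
  · module
  · simp only [om_add_right, om_smul_left, om_smul_right, om_zero_right, om_self, om_eZ, om_eZ']
    ring

section
variable [NeZero n] (D : HomDist n)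

lemma nm_mv (x : (Fin n ⊕ Fin n) × ℝ) : D.nm (mv x) = |x.2| * D.N1 := by
  rw [mv, D.nm_eq_NN, norm_smul, norm_eZ, mul_one, D.NN_r_zero (norm_nonneg _), Real.norm_eq_abs]

lemma nm_pr (L : List ((Fin n ⊕ Fin n) × ℝ)) : D.nm (pr L) ≤ D.N1 * len L := by
  induction L with
  | nil => simp [pr, len, D.nm_zero]
  | cons x L ih => 
    simp only [pr, len]
    have := D.nm_hmul_le (mv x) (pr L)
    rw [nm_mv] at this
    linarith

lemma exists_path : ∃ C : ℝ, 0 < C ∧ ∀ v : Hpt n, ∃ L, pr L = v ∧ len L ≤ C * D.nm v := by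
  have h1 := D.N1_pos
  have h2 := D.NT_pos
  set N : ℝ := ((Finset.univ : Finset (Fin n ⊕ Fin n)).toList.length : ℝ) with hN
  have hN0 : 0 ≤ N := by positivity
  refine ⟨N / D.N1 + 4 * ((N + 1) / D.NT), by positivity, fun v => ?_⟩
  obtain ⟨z, t, rfl⟩ := mkH_eta v
  set L1 := ((Finset.univ : Finset (Fin n ⊕ Fin n)).toList.map fun i => (i, z i)) with hL1
  have hz1 : zz (pr L1) = z := by rw [hL1, zz_pr_map, sum_eZ]
  obtain ⟨z', t1, hpr⟩ := mkH_eta (pr L1)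
  rw [hpr, zz_mkH] at hz1
  subst hz1
  have hlen1 : len L1 ≤ N * ‖z'‖ := len_map_le _ _
  have hzn := D.norm_le_nm z' t
  set v := mkH z' t
  have hl1 : D.N1 * len L1 ≤ N * D.nm v := by
    calc D.N1 * len L1 ≤ D.N1 * (N * ‖z'‖) := by gcongr
      _ = N * (‖z'‖ * D.N1) := by ring
      _ ≤ _ := by gcongr
  set τ := t - t1 with hτ
  have hτn : √|τ| * D.NT ≤ (N + 1) * D.nm v := by
    rw [← D.NN_zero_t, ← norm_zero (E := ZS n), ← D.nm_eq_NN]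
    have e : mkH (0 : ZS n) τ = hmul (hinv (pr L1)) v := by
      rw [hpr, hinv_mkH, hmul_mkH, om_neg_left, om_self]
      congr 1
      · simp
      · rw [hτ]; ring
    rw [e]
    have h3 := D.nm_hmul_le (hinv (pr L1)) v
    rw [D.nm_hinv] at h3
    have h4 := nm_pr D L1
    linarith
  obtain ⟨b, hb, hab⟩ : ∃ b : ℝ, |b| = √|τ| ∧ √|τ| * b = τ := by
    rcases le_total 0 τ with h | h
    · exact ⟨√|τ|, abs_of_nonneg (by positivity), by rw [Real.mul_self_sqrt (abs_nonneg _), abs_of_nonneg h]⟩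
    · refine ⟨-√|τ|, by rw [abs_neg]; exact abs_of_nonneg (by positivity), ?_⟩
      rw [mul_neg, Real.mul_self_sqrt (abs_nonneg _), abs_of_nonpos h, neg_neg]
  refine ⟨L1 ++ [(Sum.inl (0 : Fin n), √|τ|), (Sum.inr 0, b), (Sum.inl 0, -√|τ|), (Sum.inr 0, -b)], ?_, ?_⟩
  · rw [pr_append, pr_comm, hpr, hmul_mkH, om_zero_right, hab, add_zero, hτ]
    congr 1; ring
  · rw [len_append]
    simp only [len, abs_neg, hb, abs_of_nonneg (Real.sqrt_nonneg _)]
    rw [add_mul]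
    have e1 : len L1 ≤ N / D.N1 * D.nm v := by
      rw [div_mul_eq_mul_div, le_div_iff₀ h1]; linarith
    have e2 : √|τ| ≤ (N + 1) / D.NT * D.nm v := by
      rw [div_mul_eq_mul_div, le_div_iff₀ h2]; linarith
    linarith

lemma mvt_step {U : Set (Hpt n)} {f : Hpt n → ℝ} (hf : IsC1H U f) {p0 : Hpt n} {R η : ℝ} (g : ZS n)
    (hR : ∀ x, D.d p0 x < R → x ∈ U ∧ ∀ i, |gradH f x (kap i) - g i| ≤ η) (p : Hpt n) 
    (x : (Fin n ⊕ Fin n) × ℝ) (hp : D.d p0 p + D.N1 * |x.2| < R) :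
    |f (hmul p (mv x)) - f p - inner ℝ g (zz (mv x))| ≤ η * |x.2| := by
  obtain ⟨i, s⟩ := x
  simp only at hp
  have hmem : ∀ s' ∈ uIcc 0 s, D.d p0 (hmul p (mv (i, s'))) < R := by
    intro s' hs'
    have h1 := D.triangle p0 p (hmul p (mv (i, s')))
    rw [D.d_eq p, hinv_hmul_cancel, nm_mv] at h1
    have h2 : |s'| ≤ |s| := by
      have := abs_sub_left_of_mem_uIcc hs'
      simpa using this
    have h3 := D.N1_pos
    simp only at h1
    nlinarith
  have key := (convex_uIcc (0 : ℝ) s).norm_image_sub_le_of_norm_hasDerivWithin_le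
    (f := fun s => f (hmul p (mv (i, s))) - s * g i) (f' := fun s => gradH f (hmul p (mv (i, s))) (kap i) - 1 * g i)
    (C := η)
    (fun s' hs' => (((hasDerivAt_line hf p i s' (hR _ (hmem s' hs')).1).sub 
      ((hasDerivAt_id s').mul_const (g i))).hasDerivWithinAt))
    (fun s' hs' => by rw [one_mul]; exact (hR _ (hmem s' hs')).2 i)
    left_mem_uIcc right_mem_uIcc
  have e0 : hmul p (mv (i, 0)) = p := by
    rw [mv]; simp only [zero_smul]; rw [mkH_zero, hmul_zero]
  have e1 : inner ℝ g (zz (mv (i, s))) = s * g i := by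
    rw [mv, zz_mkH]; simp only
    rw [inner_smul_right]
    have : inner ℝ g (eZ i) = g i := by
      rw [real_inner_comm]; simp [eZ, EuclideanSpace.inner_single_left]
    rw [this]
  rw [e1]
  simp only [e0, zero_mul, sub_zero, Real.norm_eq_abs] at key
  convert key using 2
  ring

lemma mvt_path {U : Set (Hpt n)} {f : Hpt n → ℝ} (hf : IsC1H U f) {p0 : Hpt n} {R η : ℝ} (g : ZS n)
    (hR : ∀ x, D.d p0 x < R → x ∈ U ∧ ∀ i, |gradH f x (kap i) - g i| ≤ η)  
    (L : List ((Fin n ⊕ Fin n) × ℝ)) : ∀ p : Hpt n, D.d p0 p + D.N1 * len L < R →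
    |f (hmul p (pr L)) - f p - inner ℝ g (zz (pr L))| ≤ η * len L := by
  induction L with
  | nil => 
    intro p hp
    have : zz (0 : Hpt n) = 0 := by rw [← mkH_zero, zz_mkH]
    simp [pr, hmul_zero, len, this]
  | cons x L ih =>
    intro p hp
    simp only [pr, len] at hp ⊢
    have h0 := D.N1_pos
    have hl := len_nonneg L
    have h1 := mvt_step D hf g hR p x (by nlinarith)
    have htri := D.triangle p0 p (hmul p (mv x))
    rw [D.d_eq p, hinv_hmul_cancel, nm_mv] at htri
    have h2 := ih (hmul p (mv x)) (by linarith)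
    rw [← hmul_assoc, zz_hmul, inner_add_right]
    rw [abs_le] at *
    constructor <;> linarith [h1.1, h1.2, h2.1, h2.2]

theorem pansu_est {U : Set (Hpt n)} (hU : IsOpen U) {f : Hpt n → ℝ} (hf : IsC1H U f) {p0 : Hpt n} 
    (hp0 : p0 ∈ U) {η : ℝ} (hη : 0 < η) :
    ∃ N, IsOpen N ∧ p0 ∈ N ∧ N ⊆ U ∧ ∀ p ∈ N, ∀ q ∈ N,
      |f q - f p - inner ℝ (gv f p0) (zz (hmul (hinv p) q))| ≤ η * D.d p q := by
  obtain ⟨C, hC, hpath⟩ := exists_path D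
  have hev : ∀ᶠ x in 𝓝 p0, x ∈ U ∧ ∀ i, |gradH f x (kap i) - gv f p0 i| ≤ η / C := by
    refine (show ∀ᶠ x in 𝓝 p0, x ∈ U from hU.mem_nhds hp0).and (eventually_all.2 fun i => ?_)
    have hc : ContinuousAt (fun x => gradH f x (kap i)) p0 := 
      (hf.contGrad (kap i)).continuousAt (hU.mem_nhds hp0)
    have := hc.tendsto.eventually (Metric.closedBall_mem_nhds _ (by positivity : 0 < η / C))
    filter_upwards [this] with x hx
    rw [Real.dist_eq] at hx
    exact hx
  obtain ⟨R0, hR0, hsub⟩ := (D.hasBasis_nhds p0).mem_iff.1 hev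
  have h1 := D.N1_pos
  have hden : 0 < 1 + 2 * D.N1 * C := by positivity
  have hRR : (R0 / (1 + 2 * D.N1 * C)) * (1 + 2 * D.N1 * C) = R0 := by field_simp
  set R := R0 / (1 + 2 * D.N1 * C) with hR
  have hRpos : 0 < R := by positivity
  refine ⟨rawBall D.d p0 R, D.isOpen_ball _ _, ?_, ?_, ?_⟩
  · change D.d p0 p0 < R
    rw [D.d_self]; exact hRpos
  · intro q hq
    have hq' : D.d p0 q < R := hq
    refine (hsub (?_ : D.d p0 q < R0)).1
    have : 0 < R * (2 * D.N1 * C) := by positivity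
    linarith
  · intro p hp q hq
    have hp' : D.d p0 p < R := hp
    have hq' : D.d p0 q < R := hq
    obtain ⟨L, hL, hlen⟩ := hpath (hmul (hinv p) q)
    rw [← D.d_eq] at hlen
    have hpq : D.d p q < 2 * R := by
      have := D.triangle p p0 q
      rw [D.symm p p0] at this
      linarith
    have hb : D.N1 * len L < 2 * D.N1 * C * R := by
      calc D.N1 * len L ≤ D.N1 * (C * D.d p q) := by gcongr
        _ < D.N1 * (C * (2 * R)) := by gcongr
        _ = _ := by ring
    have := mvt_path D hf (gv f p0) (R := R0) (η := η / C) (p0 := p0) (fun x hx => hsub hx) L p (by linarith)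
    rw [hL, hmul_hinv_cancel] at this
    refine this.trans ?_
    calc η / C * len L ≤ η / C * (C * D.d p q) := by gcongr
      _ = _ := by field_simp

end

/-! Neighbourhoods of the flat case -/

section
variable [NeZero n] (D1 D2 : HomDist n) {k : ℕ} (ι : E0 n k →ₗᵢ[ℝ] ZS n)

lemma near_flat (hk1 : 1 ≤ k) (hk : k ≤ n) (g : Fin k → ZS n) 
    (hW : range (vpar ι) = {q | ∀ i, inner ℝ (g i) (zz q) = 0}) {ε : ℝ} (hε : 0 < ε) :
    ∃ η : ℝ, 0 < η ∧ ∀ c, D2.d 0 c ≤ 1 → 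
      sphPre D1.d (mexp n k : ℝ) 1 ({q | ∀ i, |inner ℝ (g i) (zz q)| ≤ η} ∩ rawBall D2.d c 1) ≤
        ENNReal.ofReal (2 ^ mexp n k * beta D2 k / beta D1 k + ε) := by
  have hβ1 := beta_pos D1 hk1 hk
  have hβ2 := beta_pos D2 hk1 hk
  set M := ENNReal.ofReal (2 ^ mexp n k * beta D2 k / beta D1 k + ε) with hM
  have hcg : ∀ i, Continuous fun q : Hpt n => |inner ℝ (g i) (zz q)| := fun i => 
    (continuous_const.inner continuous_zz).abs
  have key : ∀ c0 ∈ {c | D2.d 0 c ≤ 1}, ∀ᶠ y : ℝ × Hpt n in 𝓝 (0, c0), 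
      (D2.d 0 y.2 ≤ 1 → sphPre D1.d (mexp n k : ℝ) 1 
        ({q | ∀ i, |inner ℝ (g i) (zz q)| ≤ y.1} ∩ rawBall D2.d y.2 1) ≤ M) := by
    intro c0 _
    obtain ⟨G, hGo, hGs, hGm⟩ := sphPre_open D1 (mexp n k : ℝ) 1 (range (vpar ι) ∩ cB D2 c0 1) 
      (ε := ENNReal.ofReal ε) (by simpa using hε)
    have hGM : sphPre D1.d (mexp n k : ℝ) 1 G ≤ M := by
      refine hGm.trans ?_
      rw [hM, ENNReal.ofReal_add (by positivity) hε.le]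
      gcongr
      exact flat_ball D1 ι D2 hk1 hk one_pos c0
    have := (D2.isCompact_cball0 3).eventually_forall_of_forall_eventually (x₀ := ((0 : ℝ), c0))
      (P := fun y q => q ∈ G ∨ (∃ i, y.1 < |inner ℝ (g i) (zz q)|) ∨ 1 < D2.d y.2 q) (by
        intro q _
        by_cases hq : q ∈ G
        · have : ∀ᶠ z : (ℝ × Hpt n) × Hpt n in 𝓝 ((0, c0), q), z.2 ∈ G := 
            continuous_snd.continuousAt.eventually (hGo.mem_nhds hq)
          filter_upwards [this] with z hz using Or.inl hz
        by_cases hq2 : 1 < D2.d c0 q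
        · have hc : Continuous fun z : (ℝ × Hpt n) × Hpt n => D2.d z.1.2 z.2 := 
            D2.continuous_d.comp ((continuous_snd.comp continuous_fst).prodMk continuous_snd)
          have : ∀ᶠ z : (ℝ × Hpt n) × Hpt n in 𝓝 ((0, c0), q), 1 < D2.d z.1.2 z.2 := 
            hc.continuousAt.eventually (lt_mem_nhds hq2)
          filter_upwards [this] with z hz using Or.inr (Or.inr hz)
        have hq3 : ¬ ∀ i, inner ℝ (g i) (zz q) = 0 := by
          intro h
          refine hq (hGs ⟨?_, ?_⟩)
          · rw [hW]; exact h
          · exact not_lt.1 hq2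
        push Not at hq3
        obtain ⟨i, hi⟩ := hq3
        have : ∀ᶠ z : (ℝ × Hpt n) × Hpt n in 𝓝 ((0, c0), q), z.1.1 < |inner ℝ (g i) (zz z.2)| := by
          refine (continuous_fst.comp continuous_fst).continuousAt.eventually_lt 
            ((hcg i).comp continuous_snd).continuousAt ?_
          simpa using hi
        filter_upwards [this] with z hz using Or.inr (Or.inl ⟨i, hz⟩))
    filter_upwards [this] with y hy hyc
    refine (measure_mono ?_).trans hGM
    rintro q ⟨hq1, hq2⟩
    have hq2' : D2.d y.2 q < 1 := hq2
    have htri := D2.triangle 0 y.2 q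
    rcases hy q (by change D2.d 0 q ≤ 3; linarith) with h | ⟨i, h⟩ | h
    · exact h
    · exact absurd (hq1 i) (not_le.2 h)
    · linarith
  have h2 := (D2.isCompact_cball0 1).eventually_forall_of_forall_eventually (x₀ := (0 : ℝ))
      (P := fun η c => D2.d 0 c ≤ 1 → sphPre D1.d (mexp n k : ℝ) 1 
        ({q | ∀ i, |inner ℝ (g i) (zz q)| ≤ η} ∩ rawBall D2.d c 1) ≤ M) key
  have h3 := (h2.filter_mono (nhdsWithin_le_nhds (s := Ioi 0))).and self_mem_nhdsWithin
  obtain ⟨η, hη, hη0⟩ := h3.exists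
  exact ⟨η, hη0, fun c hc => hη c hc hc⟩

end

end Part5

section Part6
set_option linter.unusedSectionVars false

/-! ## Proof, part 6: comparison -/

lemma exists_iota {k : ℕ} (hk : k ≤ n) (g : Fin k → ZS n) (hg : LinearIndependent ℝ g) :
    ∃ ι : E0 n k →ₗᵢ[ℝ] ZS n, range (vpar ι) = {q | ∀ i, inner ℝ (g i) (zz q) = 0} := by
  set V : Submodule ℝ (ZS n) := (Submodule.span ℝ (range g))ᗮ with hV
  have h1 : Module.finrank ℝ (Submodule.span ℝ (range g)) = k := by
    rw [finrank_span_eq_card hg, Fintype.card_fin]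
  have h2 := Submodule.finrank_add_finrank_orthogonal (Submodule.span ℝ (range g))
  have h3 : Module.finrank ℝ (ZS n) = 2 * n := by
    rw [finrank_euclideanSpace, Fintype.card_sum, Fintype.card_fin]; ring
  have h4 : Module.finrank ℝ (E0 n k) = Module.finrank ℝ V := by
    rw [← hV, h1, h3] at h2
    rw [finrank_E0 hk]; omega
  let e : E0 n k ≃ₗᵢ[ℝ] V := 
    (stdOrthonormalBasis ℝ (E0 n k)).equiv (stdOrthonormalBasis ℝ V) (finCongr h4)
  refine ⟨V.subtypeₗᵢ.comp e.toLinearIsometry, ?_⟩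
  have hmem : ∀ z : ZS n, z ∈ V ↔ ∀ i, inner ℝ (g i) z = 0 := by
    intro z
    rw [hV, Submodule.mem_orthogonal]
    constructor
    · intro h i
      exact h _ (Submodule.subset_span ⟨i, rfl⟩)
    · intro h u hu
      induction hu using Submodule.span_induction with
      | mem x hx => obtain ⟨i, rfl⟩ := hx; exact h i
      | zero => exact inner_zero_left _
      | add x y _ _ hx hy => rw [inner_add_left, hx, hy, add_zero]
      | smul a x _ hx => rw [inner_smul_left, hx, mul_zero]
  ext q
  constructor
  · rintro ⟨x, rfl⟩
    change ∀ i, _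
    rw [← hmem, vpar, zz_mkH]
    exact (e x.1).2
  · intro h
    have hz : zz q ∈ V := (hmem _).2 h
    refine ⟨(e.symm ⟨zz q, hz⟩, q.2.2), ?_⟩
    have : (V.subtypeₗᵢ.comp e.toLinearIsometry) (e.symm ⟨zz q, hz⟩) = zz q := by
      simp
    simp only [vpar, this, mkH_zz]

lemma kap_surj : Function.Surjective (kap (n := n)) := by
  intro j
  by_cases h : (j : ℕ) < n
  · exact ⟨Sum.inl ⟨j, h⟩, rfl⟩
  · refine ⟨Sum.inr ⟨j - n, by omega⟩, ?_⟩
    ext; simp only [kap]; omega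

lemma gv_indep {k : ℕ} (f : Fin k → Hpt n → ℝ) (p : Hpt n) 
    (h : LinearIndependent ℝ fun i => gradH (f i) p) : LinearIndependent ℝ fun i => gv (f i) p := by
  let T : (Fin (2 * n) → ℝ) →ₗ[ℝ] ZS n := 
    { toFun := fun u => WithLp.toLp 2 fun i => u (kap i)
      map_add' := fun u v => rfl
      map_smul' := fun c u => rfl }
  have hT : LinearMap.ker T = ⊥ := by
    rw [LinearMap.ker_eq_bot]
    intro u v huv
    ext j
    obtain ⟨i, rfl⟩ := kap_surj j
    exact congrArg (fun z : ZS n => z i) huv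
  exact h.map' T hT

section
variable [NeZero n] (D1 D2 : HomDist n) {k : ℕ}

lemma blow_self (p : Hpt n) (ρ : ℝ) : blow p ρ p = 0 := by
  rw [blow, hinv_hmul, ← mkH_zero, hdil_mkH]; simp

lemma local_cmp (m : ℕ) (g : Fin k → ZS n) {η Mr : ℝ} (hM : 0 < Mr)
    (hbd : ∀ c, D2.d 0 c ≤ 1 → 
      sphPre D1.d (m : ℝ) 1 ({q | ∀ i, |inner ℝ (g i) (zz q)| ≤ η} ∩ rawBall D2.d c 1) ≤
        ENNReal.ofReal Mr) (hη : 0 < η) (A : Set (Hpt n)) 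
    (hA : ∀ p ∈ A, ∀ q ∈ A, ∀ i, |inner ℝ (g i) (zz (hmul (hinv p) q))| ≤ η / 2 * D2.d p q) 
    (δ : ℝ) :
    sphPre D1.d (m : ℝ) δ A ≤ ENNReal.ofReal (Mr / 2 ^ m) * sphPre D2.d (m : ℝ) δ A := by
  have h : OuterMeasure.restrict A (sphPre D1.d (m : ℝ) δ) ≤ 
      ENNReal.ofReal (Mr / 2 ^ m) • sphPre D2.d (m : ℝ) δ := by
    conv_rhs => rw [sphPre]
    rw [OuterMeasure.smul_boundedBy ENNReal.ofReal_ne_top, OuterMeasure.le_boundedBy]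
    intro s
    rw [OuterMeasure.restrict_apply]
    simp only [Pi.smul_apply, smul_eq_mul]
    rcases (s ∩ A).eq_empty_or_nonempty with he | ⟨p, hps, hpA⟩
    · rw [he]; simp
    have hc0 : 0 < Mr / 2 ^ m := by positivity
    rw [mul_comm (ENNReal.ofReal _), ← ENNReal.div_le_iff_le_mul (Or.inl (by simpa using hc0)) 
      (Or.inl ENNReal.ofReal_ne_top)]
    refine le_iInf fun c => le_iInf fun ρ => le_iInf fun h0 => le_iInf fun h1 => le_iInf fun hs => ?_
    rw [ENNReal.div_le_iff_le_mul (Or.inl (by simpa using hc0)) (Or.inl ENNReal.ofReal_ne_top)]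
    have hδ : δ = ρ * (δ / ρ) := by field_simp
    have hcp : D2.d c p < ρ := hs hps
    have hblow := sphPre_blow D1 (m : ℝ) (δ / ρ) p h0 (s ∩ A)
    rw [← hδ] at hblow
    refine hblow.trans ?_
    have h3 : sphPre D1.d (m : ℝ) (δ / ρ) (blow p ρ '' (s ∩ A)) ≤ ENNReal.ofReal Mr := by
      refine (sphPre_anti D1.d (m : ℝ) (r := 1) (by rw [le_div_iff₀ h0]; linarith) _).trans ?_
      have hc1 : D2.d 0 (blow p ρ c) ≤ 1 := by
        rw [← blow_self p ρ, blow_d D2 p h0, inv_mul_le_iff₀ h0, D2.symm]; linarith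
      refine (measure_mono ?_).trans (hbd (blow p ρ c) hc1)
      rintro _ ⟨q, ⟨hqs, hqA⟩, rfl⟩
      have hcq : D2.d c q < ρ := hs hqs
      refine ⟨fun i => ?_, ?_⟩
      · rw [blow, zz_hdil, inner_smul_right, abs_mul, abs_of_pos (inv_pos.2 h0), inv_mul_le_iff₀ h0]
        refine (hA p hpA q hqA i).trans ?_
        have htri := D2.triangle p c q
        rw [D2.symm p c] at htri
        nlinarith
      · change D2.d (blow p ρ c) (blow p ρ q) < 1
        rw [blow_d D2 p h0, inv_mul_lt_iff₀ h0]; linarith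
    calc ENNReal.ofReal (ρ ^ (m : ℝ)) * sphPre D1.d (m : ℝ) (δ / ρ) (blow p ρ '' (s ∩ A)) 
        ≤ ENNReal.ofReal (ρ ^ (m : ℝ)) * ENNReal.ofReal Mr := by gcongr
      _ = _ := by
        rw [← ENNReal.ofReal_mul (by positivity), ← ENNReal.ofReal_mul (by positivity)]
        congr 1
        rw [Real.rpow_natCast, Real.rpow_natCast, mul_pow]
        field_simp
  have h2 := h A
  rw [OuterMeasure.restrict_apply, inter_self] at h2
  exact h2

lemma outer_cmp (m : ℝ) (c : ℝ≥0∞) (A : Set (Hpt n)) 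
    (h : ∀ δ, sphPre D1.d m δ A ≤ c * sphPre D2.d m δ A) : 
    sphOuter D1.d m A ≤ c * sphOuter D2.d m A := by
  simp only [sphOuter, OuterMeasure.iSup_apply]
  refine iSup_le fun δ => iSup_le fun hδ => (h δ).trans ?_
  gcongr
  exact le_iSup₂_of_le δ hδ le_rfl

lemma local_main (hk1 : 1 ≤ k) (hk : k ≤ n) {S : Set (Hpt n)} (hS : IsC1HCodim k S) {p0 : Hpt n} 
    (hp0 : p0 ∈ S) {ε : ℝ} (hε : 0 < ε) : 
    ∃ N, IsOpen N ∧ p0 ∈ N ∧ MeasurableSet (S ∩ N) ∧ ∀ A ⊆ S ∩ N, 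
      sphOuter D1.d (mexp n k : ℝ) A ≤ 
        ENNReal.ofReal (beta D2 k / beta D1 k + ε) * sphOuter D2.d (mexp n k : ℝ) A := by
  have hβ1 := beta_pos D1 hk1 hk
  have hβ2 := beta_pos D2 hk1 hk
  obtain ⟨U, hU, hpU, f, hf, hind, hSU⟩ := hS p0 hp0
  obtain ⟨ι, hι⟩ := exists_iota hk _ (gv_indep f p0 (hind p0 hpU))
  obtain ⟨η, hη, hbd⟩ := near_flat D1 D2 ι hk1 hk _ hι 
    (ε := ε * 2 ^ mexp n k) (by positivity)
  choose N hNo hpN hNU hN using fun i => pansu_est D2 hU (hf i) hpU (half_pos hη)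
  have hNopen : IsOpen (U ∩ ⋂ i, N i) := hU.inter (isOpen_iInter_of_finite hNo)
  have hSN : S ∩ (U ∩ ⋂ i, N i) = 
      (U ∩ ⋂ i, N i) \ ⋃ i, (U ∩ ⋂ i, N i) ∩ f i ⁻¹' {0}ᶜ := by
    ext q
    have hq := Set.ext_iff.1 hSU q
    constructor
    · rintro ⟨h1, h2⟩
      refine ⟨h2, fun h => ?_⟩
      obtain ⟨i, hi⟩ := mem_iUnion.1 h
      exact hi.2 ((hq.1 ⟨h1, h2.1⟩).2 i)
    · rintro ⟨h1, h2⟩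
      refine ⟨(hq.2 ⟨h1.1, fun i => ?_⟩).1, h1⟩
      by_contra hne
      exact h2 (mem_iUnion.2 ⟨i, h1, hne⟩)
  refine ⟨U ∩ ⋂ i, N i, hNopen, ⟨hpU, mem_iInter.2 hpN⟩, ?_, fun A hA => ?_⟩
  · rw [hSN]
    refine hNopen.measurableSet.diff (MeasurableSet.iUnion fun i => ?_)
    exact (((hf i).contOn.mono inter_subset_left).isOpen_inter_preimage hNopen 
      isOpen_compl_singleton).measurableSet
  · refine outer_cmp D1 D2 _ _ A fun δ => ?_
    have := local_cmp D1 D2 (mexp n k) (fun i => gv (f i) p0) 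
      (by positivity) hbd hη A (fun p hp q hq i => ?_) δ
    · convert this using 3
      field_simp
    · have e : ∀ x ∈ A, f i x = 0 := fun x hx => 
        ((Set.ext_iff.1 hSU x).1 ⟨(hA hx).1, (hA hx).2.1⟩).2 i
      have h1 := hN i p (mem_iInter.1 (hA hp).2.2 i) q (mem_iInter.1 (hA hq).2.2 i)
      rw [e p hp, e q hq, sub_zero, zero_sub, abs_neg] at h1
      exact h1

lemma global_eps (hk1 : 1 ≤ k) (hk : k ≤ n) {S : Set (Hpt n)} (hS : IsC1HCodim k S) 
    {ε : ℝ} (hε : 0 < ε) : MeasurableSet S ∧ ∀ A, MeasurableSet A → A ⊆ S →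
      sphMeasure D1 (mexp n k : ℝ) A ≤ 
        ENNReal.ofReal (beta D2 k / beta D1 k + ε) * sphMeasure D2 (mexp n k : ℝ) A := by
  rcases S.eq_empty_or_nonempty with rfl | hne
  · refine ⟨MeasurableSet.empty, fun A _ h => ?_⟩
    rw [subset_empty_iff.1 h]; simp
  have : ∀ p : Hpt n, ∃ N, p ∈ S → (IsOpen N ∧ p ∈ N ∧ MeasurableSet (S ∩ N) ∧ ∀ A ⊆ S ∩ N, 
      sphOuter D1.d (mexp n k : ℝ) A ≤ 
        ENNReal.ofReal (beta D2 k / beta D1 k + ε) * sphOuter D2.d (mexp n k : ℝ) A) := by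
    intro p
    by_cases hp : p ∈ S
    · obtain ⟨N, hN⟩ := local_main D1 D2 hk1 hk hS hp hε
      exact ⟨N, fun _ => hN⟩
    · exact ⟨∅, fun h => absurd h hp⟩
  choose N hN using this
  obtain ⟨t, hts, htc, hcov⟩ := TopologicalSpace.countable_cover_nhdsWithin (s := S) (f := N) 
    fun p hp => mem_nhdsWithin_of_mem_nhds ((hN p hp).1.mem_nhds (hN p hp).2.1)
  have htne : t.Nonempty := by
    obtain ⟨p, hp⟩ := hne
    obtain ⟨x, hx, -⟩ := mem_iUnion₂.1 (hcov hp)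
    exact ⟨x, hx⟩
  obtain ⟨u, rfl⟩ := htc.exists_eq_range htne
  have huS : ∀ j, u j ∈ S := fun j => hts ⟨j, rfl⟩
  set B : ℕ → Set (Hpt n) := fun j => S ∩ N (u j) with hB
  have hBm : ∀ j, MeasurableSet (B j) := fun j => (hN _ (huS j)).2.2.1
  have hSB : S = ⋃ j, B j := by
    ext q
    constructor
    · intro hq
      obtain ⟨x, ⟨j, rfl⟩, hx⟩ := mem_iUnion₂.1 (hcov hq)
      exact mem_iUnion.2 ⟨j, hq, hx⟩
    · intro hq
      obtain ⟨j, hj⟩ := mem_iUnion.1 hq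
      exact hj.1
  refine ⟨hSB ▸ MeasurableSet.iUnion hBm, fun A hA hAS => ?_⟩
  have hdm : ∀ j, MeasurableSet (A ∩ disjointed B j) := fun j => 
    hA.inter (MeasurableSet.disjointed hBm j)
  have hAeq : A = ⋃ j, A ∩ disjointed B j := by
    rw [← inter_iUnion, iUnion_disjointed, ← hSB, inter_eq_left.2 hAS]
  have hdis : Pairwise (Function.onFun Disjoint fun j => A ∩ disjointed B j) := fun i j hij => 
    (disjoint_disjointed B hij).mono inter_subset_right inter_subset_right
  rw [hAeq, measure_iUnion hdis hdm, measure_iUnion hdis hdm, ← ENNReal.tsum_mul_left]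
  refine ENNReal.tsum_le_tsum fun j => ?_
  rw [sphMeasure, sphMeasure, toMeasure_apply _ _ (hdm j), toMeasure_apply _ _ (hdm j)]
  exact (hN _ (huS j)).2.2.2 _ (inter_subset_right.trans (disjointed_subset B j))

lemma global_le (hk1 : 1 ≤ k) (hk : k ≤ n) {S : Set (Hpt n)} (hS : IsC1HCodim k S) 
    {A : Set (Hpt n)} (hA : MeasurableSet A) (hAS : A ⊆ S) :
    ENNReal.ofReal (beta D1 k) * sphMeasure D1 (mexp n k : ℝ) A ≤ 
        ENNReal.ofReal (beta D2 k) * sphMeasure D2 (mexp n k : ℝ) A := by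
  have hβ1 := beta_pos D1 hk1 hk
  have hβ2 := beta_pos D2 hk1 hk
  by_cases htop : sphMeasure D2 (mexp n k : ℝ) A = ⊤
  · rw [htop, ENNReal.mul_top (by simpa using hβ2)]; exact le_top
  have hlim : Tendsto (fun ε : ℝ => ENNReal.ofReal (beta D2 k + beta D1 k * ε) * 
      sphMeasure D2 (mexp n k : ℝ) A) (𝓝[>] 0) 
      (𝓝 (ENNReal.ofReal (beta D2 k) * sphMeasure D2 (mexp n k : ℝ) A)) := by
    refine ENNReal.Tendsto.mul_const ?_ (Or.inr htop)
    refine ENNReal.tendsto_ofReal ?_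
    have hc : Continuous fun ε : ℝ => beta D2 k + beta D1 k * ε := by fun_prop
    have := hc.tendsto 0
    simp only [mul_zero, add_zero] at this
    exact this.mono_left nhdsWithin_le_nhds
  refine ge_of_tendsto hlim ?_
  filter_upwards [self_mem_nhdsWithin] with ε hε
  have hε' : 0 < ε := hε
  have h1 := (global_eps D1 D2 hk1 hk hS hε').2 A hA hAS
  calc ENNReal.ofReal (beta D1 k) * sphMeasure D1 (mexp n k : ℝ) A 
      ≤ ENNReal.ofReal (beta D1 k) * (ENNReal.ofReal (beta D2 k / beta D1 k + ε) * 
        sphMeasure D2 (mexp n k : ℝ) A) := by gcongr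
    _ = _ := by
      rw [← mul_assoc, ← ENNReal.ofReal_mul hβ1.le]
      congr 2
      field_simp

lemma restrict_eq (hk1 : 1 ≤ k) (hk : k ≤ n) {S : Set (Hpt n)} (hS : IsC1HCodim k S) :
    ENNReal.ofReal (beta D1 k) • (sphMeasure D1 (mexp n k : ℝ)).restrict S = 
      ENNReal.ofReal (beta D2 k) • (sphMeasure D2 (mexp n k : ℝ)).restrict S := by
  have hSm := (global_eps D1 D2 hk1 hk hS one_pos).1
  ext A hA
  simp only [Measure.smul_apply, smul_eq_mul, Measure.restrict_apply hA]
  exact le_antisymm (global_le D1 D2 hk1 hk hS (hA.inter hSm) inter_subset_right)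
    (global_le D2 D1 hk1 hk hS (hA.inter hSm) inter_subset_right)

lemma currF_eq (D : HomDist n) (hk1 : 1 ≤ k) (hk : k ≤ n) (S : Set (Hpt n)) 
    (t : Hpt n → MVec n (2*n+1-k)) (η : Hpt n → (Fin (2*n+1-k) → Hpt n) → ℝ) :
    currF D k S t η = ∫ p, pairF (t p) p (η p) 
      ∂(ENNReal.ofReal (beta D k) • (sphMeasure D (mexp n k : ℝ)).restrict S) := by
  have hm : ((2 * n + 2 : ℝ) - (k : ℝ)) = (mexp n k : ℝ) := by
    rw [mexp, finrank_E0 hk, Nat.cast_add, Nat.cast_sub (by omega)]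
    push_cast; ring
  rw [integral_smul_measure, currF, hm, CnkC, inv_inv, ENNReal.toReal_ofReal (beta_pos D hk1 hk).le]
  rfl

end

end Part6

/-- **Independence of the Heisenberg current from the chosen distance** (Lemma 2.18): if
`d₁, d₂` are two left invariant, homogeneous and rotationally invariant distances on `ℍⁿ`,
with associated spherical measures `𝒮^m₁, 𝒮^m₂` and constants `C¹_{n,k}, C²_{n,k}`, and
`S ⊆ O` is an oriented `k`-codimensional `C¹_ℍ`-regular submanifold with both measures locally
finite on `O`, then
`(1/C¹_{n,k})∫_S⟨t^ℍ_S|ω⟩d𝒮^{Q−k}₁ = (1/C²_{n,k})∫_S⟨t^ℍ_S|ω⟩d𝒮^{Q−k}₂`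
for every `ω ∈ 𝒟^{2n+1−k}_ℍ(O)`. -/
theorem current_distance_independent {n : ℕ} (hn : 1 ≤ n)
    (k : ℕ) (hk1 : 1 ≤ k) (hk2 : k ≤ n)
    (O : Set (Hpt n)) (hO : IsOpen O) (D1 D2 : HomDist n)
    (S : Set (Hpt n)) (hSO : S ⊆ O) (hS : IsC1HCodim k S)
    (tS : Hpt n → MVec n (2*n+1-k)) (htS : IsHOrient k (2*n+1-k) S tS)
    (hfin1 : LocFin (sphMeasure D1 ((2*n+2 : ℝ) - (k:ℝ))) S O)
    (hfin2 : LocFin (sphMeasure D2 ((2*n+2 : ℝ) - (k:ℝ))) S O)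
    (ω : Hpt n → Cov n (2*n+1-k)) (hω : IsHFormD (2*n+1-k) O ω) :
    currF D1 k S tS (fun p v => ω p v) = currF D2 k S tS (fun p v => ω p v) := by
  have : NeZero n := ⟨by omega⟩
  rw [currF_eq D1 hk1 hk2, currF_eq D2 hk1 hk2, restrict_eq D1 D2 hk1 hk2 hS]

end Heis
end
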